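/- arXiv:1510.02533 — 5 statements merged into one kernel-verified Lean document; each statement's English description precedes it below -/
import Mathlib

section
/- Fix constants α ≥ 2 and β ≥ 2 satisfying 2/α − 1/α² − β + β/α ≤ 0, and assume n ≥ βL/μ. Initialize the Finito table with φ_i^0 = φ^0 for all i and run k Finito update steps, choosing the index at each step independently and uniformly at random from {1,…,n} (so the expectation E below is the average over all n^k index sequences). Then E[f(φ̄^k)] − f(w*) ≤ ((1 − 1/(2α))/μ) (1 − 1/(αn))^k ‖∇f(φ^0)‖². -/
open scoped RealInnerProductSpace

/-- The Finito point associated with a table `φ`. -/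
noncomputable def finitoW (d n : ℕ) (α μ : ℝ)
    (f' : Fin n → EuclideanSpace ℝ (Fin d) → EuclideanSpace ℝ (Fin d))
    (φ : Fin n → EuclideanSpace ℝ (Fin d)) : EuclideanSpace ℝ (Fin d) :=
  (1 / (n : ℝ)) • ∑ i, φ i - (1 / (α * μ * n)) • ∑ i, f' i (φ i)

/-- The Finito table after `k` update steps, with index sequence `js`:
at each step the chosen table entry is replaced by the current Finito point. -/
noncomputable def finitoIter (d n : ℕ) (α μ : ℝ)
    (f' : Fin n → EuclideanSpace ℝ (Fin d) → EuclideanSpace ℝ (Fin d))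
    (φ0 : Fin n → EuclideanSpace ℝ (Fin d)) (js : ℕ → Fin n) :
    ℕ → Fin n → EuclideanSpace ℝ (Fin d)
  | 0 => φ0
  | k + 1 =>
      Function.update (finitoIter d n α μ f' φ0 js k) (js k)
        (finitoW d n α μ f' (finitoIter d n α μ f' φ0 js k))

/-- Extends a finite index sequence to an infinite one (the tail is irrelevant). -/
def extSeq {n : ℕ} (hn : 0 < n) {k : ℕ} (js : Fin k → Fin n) : ℕ → Fin n :=
  fun t => if h : t < k then js ⟨t, h⟩ else ⟨0, hn⟩

section FinitoAux

variable {E : Type*} [NormedAddCommGroup E] [InnerProductSpace ℝ E]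

/-- Descent lemma. -/
lemma finito_descent [CompleteSpace E] (L : ℝ) (h : E → ℝ) (h' : E → E)
    (hgrad : ∀ x, HasGradientAt h (h' x) x)
    (hsm : ∀ x y, ‖h' x - h' y‖ ≤ L * ‖x - y‖) (x y : E) :
    h y ≤ h x + ⟪h' x, y - x⟫ + L / 2 * ‖y - x‖ ^ 2 := by
  set v := y - x with hv
  set φ : ℝ → ℝ := fun t => h (x + t • v) - t * ⟪h' x, v⟫ - L / 2 * t ^ 2 * ‖v‖ ^ 2 with hφ
  have hd : ∀ t : ℝ, HasDerivAt φ (⟪h' (x + t • v), v⟫ - ⟪h' x, v⟫ - L * t * ‖v‖ ^ 2) t := by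
    intro t
    have h1 : HasDerivAt (fun t : ℝ => x + t • v) v t := by
      simpa using ((hasDerivAt_id t).smul_const v).const_add x
    have h2 := (hgrad (x + t • v)).hasFDerivAt.comp_hasDerivAt t h1
    have h2' : HasDerivAt (fun t : ℝ => h (x + t • v)) ⟪h' (x + t • v), v⟫ t := by
      simpa [Function.comp_def] using h2
    have h3 : HasDerivAt (fun t : ℝ => t * ⟪h' x, v⟫) (⟪h' x, v⟫) t := by
      simpa using (hasDerivAt_id t).mul_const ⟪h' x, v⟫
    have h4 : HasDerivAt (fun t : ℝ => L / 2 * t ^ 2 * ‖v‖ ^ 2) (L * t * ‖v‖ ^ 2) t := by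
      have := (((hasDerivAt_id t).pow 2).const_mul (L / 2)).mul_const (‖v‖ ^ 2)
      refine this.congr_deriv ?_
      simp only [id, Nat.cast_ofNat]
      ring
    exact (h2'.sub h3).sub h4
  have hanti : AntitoneOn φ (Set.Icc 0 1) := by
    apply antitoneOn_of_deriv_nonpos (convex_Icc 0 1)
    · exact fun t _ => (hd t).continuousAt.continuousWithinAt
    · exact fun t _ => (hd t).differentiableAt.differentiableWithinAt
    · intro t ht
      rw [interior_Icc] at ht
      rw [(hd t).deriv, ← inner_sub_left]
      have h1 := real_inner_le_norm (h' (x + t • v) - h' x) v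
      have h2 := hsm (x + t • v) x
      rw [add_sub_cancel_left, norm_smul, Real.norm_of_nonneg ht.1.le] at h2
      have := mul_le_mul_of_nonneg_right h2 (norm_nonneg v)
      nlinarith
  have := hanti (Set.left_mem_Icc.2 zero_le_one) (Set.right_mem_Icc.2 zero_le_one) zero_le_one
  simp only [hφ, one_smul, zero_smul, add_zero] at this
  have e : x + v = y := by rw [hv]; abel
  rw [e] at this
  linarith

/-- Interpolation inequality for smooth strongly convex functions. -/
lemma finito_interp (L μ : ℝ) (hlt : μ < L) (h : E → ℝ) (h' : E → E)
    (hdes : ∀ x y, h y ≤ h x + ⟪h' x, y - x⟫ + L / 2 * ‖y - x‖ ^ 2)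
    (hsc : ∀ x y, h x ≥ h y + ⟪h' y, x - y⟫ + μ / 2 * ‖x - y‖ ^ 2) (x y : E) :
    ‖h' x - h' y‖ ^ 2 + μ * L * ‖x - y‖ ^ 2 - 2 * μ * ⟪h' x - h' y, x - y⟫
      ≤ 2 * (L - μ) * (h x - h y - ⟪h' y, x - y⟫) := by
  have hm : 0 < L - μ := by linarith
  obtain ⟨g, hg⟩ : ∃ g, g = h' x - h' y := ⟨_, rfl⟩
  obtain ⟨δ, hδ⟩ : ∃ δ, δ = x - y := ⟨_, rfl⟩
  obtain ⟨r, hr⟩ : ∃ r, r = 1 / (L - μ) := ⟨_, rfl⟩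
  have h1 := hdes x (x - r • (g - μ • δ))
  have h2 := hsc (x - r • (g - μ • δ)) y
  have e1 : x - r • (g - μ • δ) - x = -(r • (g - μ • δ)) := by abel
  have e2 : x - r • (g - μ • δ) - y = δ - r • (g - μ • δ) := by rw [hδ]; abel
  have e3 : h' x = h' y + g := by rw [hg]; abel
  rw [e1, e3] at h1
  rw [e2] at h2
  rw [← hg, ← hδ]
  simp only [← real_inner_self_eq_norm_sq, inner_add_left, inner_sub_left, inner_sub_right,
    inner_smul_left, inner_smul_right, inner_neg_left, inner_neg_right,
    real_inner_comm g δ, RCLike.conj_to_real] at h1 h2 ⊢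
  have hrm : r * (L - μ) = 1 := by rw [hr]; field_simp
  have hr2 : r ^ 2 * (L - μ) = r := by rw [pow_two, mul_assoc, hrm, mul_one]
  have key : h x - h y - ⟪h' y, δ⟫ ≥ μ / 2 * ⟪δ, δ⟫ +
      r / 2 * (⟪g, g⟫ - 2 * μ * ⟪g, δ⟫ + μ ^ 2 * ⟪δ, δ⟫) := by
    linear_combination h1 + h2 + (⟪g, g⟫ - 2 * μ * ⟪g, δ⟫ + μ ^ 2 * ⟪δ, δ⟫) / 2 * hr2
  have := mul_le_mul_of_nonneg_left key hm.le
  linear_combination 2 * this + (⟪g, g⟫ - 2 * μ * ⟪g, δ⟫ + μ ^ 2 * ⟪δ, δ⟫) * (-hrm)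

/-- The per-component inequality. -/
lemma finito_component (L μ α β n : ℝ) (hμ : 0 < μ) (hμL : μ ≤ L) (hα : 2 ≤ α) (hβ : 2 ≤ β)
    (hcond : 2 / α - 1 / α ^ 2 - β + β / α ≤ 0) (hbig : β * L / μ ≤ n)
    (h : E → ℝ) (h' : E → E)
    (hsm : ∀ x y, ‖h' x - h' y‖ ≤ L * ‖x - y‖)
    (hdes : ∀ x y, h y ≤ h x + ⟪h' x, y - x⟫ + L / 2 * ‖y - x‖ ^ 2)
    (hsc : ∀ x y, h x ≥ h y + ⟪h' y, x - y⟫ + μ / 2 * ‖x - y‖ ^ 2) (x y : E) :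
    L / 2 * ‖x - y‖ ^ 2 + (1 / (α * μ) * (1 - 1 / (2 * α))) * ‖h' x - h' y‖ ^ 2
      - ⟪h' x - h' y, x - y⟫ ≤ n * ((1 - 1 / α) * (h x - h y - ⟪h' y, x - y⟫)) := by
  have hα0 : 0 < α := by linarith
  have hL : 0 < L := by linarith
  obtain ⟨θ, hθ⟩ : ∃ θ, θ = 1 - 1 / α := ⟨_, rfl⟩
  have hθ2 : 1 / 2 ≤ θ := by
    have : 1 / α ≤ 1 / 2 := one_div_le_one_div_of_le (by norm_num) hα
    linarith
  obtain ⟨K, hK⟩ : ∃ K, K = β * θ := ⟨_, rfl⟩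
  have hK1 : 1 ≤ K := by rw [hK]; nlinarith
  have hc : 1 / (α * μ) * (1 - 1 / (2 * α)) ≤ K / (2 * μ) := by
    have e : 1 / (α * μ) * (1 - 1 / (2 * α)) = (2 / α - 1 / α ^ 2) / (2 * μ) := by
      field_simp
    rw [e]
    apply div_le_div_of_nonneg_right _ (by positivity)
    rw [hK, hθ]
    have : β * (1 - 1 / α) = β - β / α := by ring
    linarith
  have hD := hsc x y
  have hmono := hsc y x
  have hg2 := hsm x y
  obtain ⟨D, hDd⟩ : ∃ D, D = h x - h y - ⟪h' y, x - y⟫ := ⟨_, rfl⟩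
  have hD0 : μ / 2 * ‖x - y‖ ^ 2 ≤ D := by rw [hDd]; linarith
  have hDn : 0 ≤ D := le_trans (by positivity) hD0
  have hnD : K * L / μ * D ≤ n * (θ * D) := by
    have : β * L / μ * (θ * D) ≤ n * (θ * D) :=
      mul_le_mul_of_nonneg_right hbig (mul_nonneg (by linarith) hDn)
    calc K * L / μ * D = β * L / μ * (θ * D) := by rw [hK]; ring
      _ ≤ _ := this
  rw [← hθ, ← hDd]
  refine le_trans ?_ hnD
  have hcg := mul_le_mul_of_nonneg_right hc (sq_nonneg ‖h' x - h' y‖)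
  suffices hs : L / 2 * ‖x - y‖ ^ 2 + K / (2 * μ) * ‖h' x - h' y‖ ^ 2
      - ⟪h' x - h' y, x - y⟫ ≤ K * L / μ * D by linarith
  rcases hμL.eq_or_lt with heq | hlt
  · subst heq
    have hmon : μ * ‖x - y‖ ^ 2 ≤ ⟪h' x - h' y, x - y⟫ := by
      have e : y - x = -(x - y) := by abel
      rw [e, norm_neg, inner_neg_right] at hmono
      rw [inner_sub_left]
      linarith
    have hgs : ‖h' x - h' y‖ ^ 2 ≤ μ ^ 2 * ‖x - y‖ ^ 2 := by
      rw [← mul_pow]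
      exact pow_le_pow_left₀ (norm_nonneg _) hg2 2
    have h1 : K / (2 * μ) * ‖h' x - h' y‖ ^ 2 ≤ K / (2 * μ) * (μ ^ 2 * ‖x - y‖ ^ 2) :=
      mul_le_mul_of_nonneg_left hgs (by positivity)
    have e1 : K / (2 * μ) * (μ ^ 2 * ‖x - y‖ ^ 2) = K * (μ / 2 * ‖x - y‖ ^ 2) := by
      field_simp
    have e2 : K * μ / μ * D = K * D := by field_simp
    rw [e2]
    have h3 := mul_le_mul_of_nonneg_left hD0 (by linarith : 0 ≤ K)
    have : 0 ≤ μ * ‖x - y‖ ^ 2 := by positivity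
    linarith
  · have hint := finito_interp L μ hlt h h' hdes hsc x y
    rw [← hDd] at hint
    have hm : 0 < L - μ := by linarith
    obtain ⟨g, hg⟩ : ∃ g, g = h' x - h' y := ⟨_, rfl⟩
    obtain ⟨δ, hδ⟩ : ∃ δ, δ = x - y := ⟨_, rfl⟩
    rw [← hg, ← hδ] at hint ⊢
    obtain ⟨q, hq⟩ : ∃ q, q = K * L - (L - μ) := ⟨_, rfl⟩
    have hq0 : 0 < q := by rw [hq]; nlinarith
    have hquad : 0 ≤ K * (K * ‖g‖ ^ 2 + L * q * ‖δ‖ ^ 2 - 2 * q * ⟪g, δ⟫) := by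
      have hs : 0 ≤ ‖K • g - q • δ‖ ^ 2 := sq_nonneg _
      rw [norm_sub_sq_real, norm_smul, norm_smul, inner_smul_left, inner_smul_right, mul_pow,
        mul_pow, Real.norm_eq_abs, Real.norm_eq_abs, sq_abs, sq_abs, RCLike.conj_to_real] at hs
      have : 0 ≤ q * (L - μ) * ‖δ‖ ^ 2 := by positivity
      have e : q * (L - μ) = q * (K * L) - q ^ 2 := by rw [hq]; ring
      rw [e] at this
      linarith
    have hquad' := nonneg_of_mul_nonneg_right hquad (by linarith : 0 < K)
    rw [← sub_nonneg]
    have hKL : 0 ≤ K * L := by positivity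
    have h4 := mul_le_mul_of_nonneg_left hint hKL
    have e : K * L / μ * D - (L / 2 * ‖δ‖ ^ 2 + K / (2 * μ) * ‖g‖ ^ 2 - ⟪g, δ⟫)
      = (K * L * (2 * (L - μ) * D) - (μ * L * (L - μ) * ‖δ‖ ^ 2 + K * (L - μ) * ‖g‖ ^ 2
          - 2 * μ * (L - μ) * ⟪g, δ⟫)) / (2 * μ * (L - μ)) := by
      field_simp
      try ring
    rw [e]
    apply div_nonneg _ (by positivity)
    have h5 := mul_nonneg hμ.le hquad'
    rw [hq] at h5
    linarith

end FinitoAux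

section FinitoMain

variable {E : Type*} [NormedAddCommGroup E] [InnerProductSpace ℝ E]

/-- Table average. -/
noncomputable def finitoAvg {n : ℕ} (φ : Fin n → E) : E := (1 / (n : ℝ)) • ∑ i, φ i

/-- Lyapunov function. -/
noncomputable def finitoT {n : ℕ} (c : ℝ) (f : Fin n → E → ℝ) (f' : Fin n → E → E)
    (φ : Fin n → E) : ℝ :=
  (1 / (n : ℝ)) * ∑ i, f i (finitoAvg φ)
    - (1 / (n : ℝ)) * ∑ i, (f i (φ i) - ⟪f' i (φ i), φ i⟫)
    - ⟪finitoAvg (fun i => f' i (φ i)), finitoAvg φ⟫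
    + c * ‖finitoAvg (fun i => f' i (φ i))‖ ^ 2

lemma finitoAvg_const {n : ℕ} (hn : 0 < n) (x : E) : finitoAvg (fun _ : Fin n => x) = x := by
  have : (n : ℝ) ≠ 0 := by positivity
  simp [finitoAvg, ← Nat.cast_smul_eq_nsmul ℝ, smul_smul, this]

lemma finito_sum_eq {n : ℕ} (hn : 0 < n) (φ : Fin n → E) :
    ∑ i, φ i = (n : ℝ) • finitoAvg φ := by
  have : (n : ℝ) ≠ 0 := by positivity
  simp [finitoAvg, smul_smul, this]

lemma finito_update_sum {n : ℕ} {X M : Type*} [AddCommGroup M] (φ : Fin n → X) (j : Fin n)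
    (w : X) (u : Fin n → X → M) :
    ∑ i, u i (Function.update φ j w i) = ∑ i, u i (φ i) + (u j w - u j (φ j)) := by
  have h1 : ∀ i, u i (Function.update φ j w i)
      = u i (φ i) + (if i = j then u j w - u j (φ j) else 0) := by
    intro i
    by_cases h : i = j
    · subst h; simp
    · simp [h]
  simp_rw [h1]
  rw [Finset.sum_add_distrib]
  simp

lemma finitoAvg_update {n : ℕ} (φ : Fin n → E) (j : Fin n) (w : E) (u : Fin n → E → E) :
    finitoAvg (fun i => u i (Function.update φ j w i))
      = finitoAvg (fun i => u i (φ i)) + (1 / (n : ℝ)) • (u j w - u j (φ j)) := by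
  rw [finitoAvg, finito_update_sum, smul_add]; rfl

/-- Averages of strongly convex functions. -/
lemma finito_avg_sc {n : ℕ} (hn : 0 < n) (μ : ℝ) (f : Fin n → E → ℝ) (f' : Fin n → E → E)
    (hsc : ∀ i x y, f i x ≥ f i y + ⟪f' i y, x - y⟫ + μ / 2 * ‖x - y‖ ^ 2) (x y : E) :
    (1 / (n : ℝ)) * ∑ i, f i x ≥ (1 / (n : ℝ)) * ∑ i, f i y
      + ⟪finitoAvg (fun i => f' i y), x - y⟫ + μ / 2 * ‖x - y‖ ^ 2 := by
  have hn0 : (0 : ℝ) < n := by positivity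
  have h := Finset.sum_le_sum (fun i (_ : i ∈ Finset.univ) => hsc i x y)
  simp only [Finset.sum_add_distrib, ← sum_inner, Finset.sum_const, Finset.card_univ,
    Fintype.card_fin, nsmul_eq_mul] at h
  rw [finito_sum_eq hn (fun i => f' i y), inner_smul_left, RCLike.conj_to_real] at h
  have h2 := mul_le_mul_of_nonneg_left h (by positivity : (0 : ℝ) ≤ 1 / n)
  have e : (1 / (n : ℝ)) * n = 1 := by field_simp
  linear_combination h2 + (⟪finitoAvg (fun i => f' i y), x - y⟫ + μ / 2 * ‖x - y‖ ^ 2) * (-e)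

lemma finito_avg_des {n : ℕ} (hn : 0 < n) (L : ℝ) (f : Fin n → E → ℝ) (f' : Fin n → E → E)
    (hdes : ∀ i x y, f i y ≤ f i x + ⟪f' i x, y - x⟫ + L / 2 * ‖y - x‖ ^ 2) (x y : E) :
    (1 / (n : ℝ)) * ∑ i, f i y ≤ (1 / (n : ℝ)) * ∑ i, f i x
      + ⟪finitoAvg (fun i => f' i x), y - x⟫ + L / 2 * ‖y - x‖ ^ 2 := by
  have hn0 : (0 : ℝ) < n := by positivity
  have h := Finset.sum_le_sum (fun i (_ : i ∈ Finset.univ) => hdes i x y)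
  simp only [Finset.sum_add_distrib, ← sum_inner, Finset.sum_const, Finset.card_univ,
    Fintype.card_fin, nsmul_eq_mul] at h
  rw [finito_sum_eq hn (fun i => f' i x), inner_smul_left, RCLike.conj_to_real] at h
  have h2 := mul_le_mul_of_nonneg_left h (by positivity : (0 : ℝ) ≤ 1 / n)
  have e : (1 / (n : ℝ)) * n = 1 := by field_simp
  linear_combination h2 + (⟪finitoAvg (fun i => f' i x), y - x⟫ + L / 2 * ‖y - x‖ ^ 2) * e

/-- Progress for one choice of index. -/
lemma finito_step_one {n : ℕ} (hn : 0 < n) (L c τ : ℝ) (f : Fin n → E → ℝ) (f' : Fin n → E → E)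
    (hdes : ∀ i x y, f i y ≤ f i x + ⟪f' i x, y - x⟫ + L / 2 * ‖y - x‖ ^ 2)
    (hcomp : ∀ i x y, L / 2 * ‖x - y‖ ^ 2 + c * ‖f' i x - f' i y‖ ^ 2
      - ⟪f' i x - f' i y, x - y⟫ ≤ n * ((1 - τ) * (f i x - f i y - ⟪f' i y, x - y⟫)))
    (φ : Fin n → E) (w : E) (j : Fin n) :
    n * (finitoT c f f' (Function.update φ j w) - finitoT c f f' φ) ≤
      ⟪finitoAvg (fun i => f' i (finitoAvg φ)) - finitoAvg (fun i => f' i (φ i)), w - φ j⟫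
      - τ * (f j w - f j (φ j) - ⟪f' j (φ j), w - φ j⟫)
      + ⟪f' j w - f' j (φ j), w - finitoAvg φ⟫
      + 2 * c * ⟪finitoAvg (fun i => f' i (φ i)), f' j w - f' j (φ j)⟫ := by
  have hn0 : (0 : ℝ) < n := by positivity
  unfold finitoT
  have em : finitoAvg (Function.update φ j w) = finitoAvg φ + (1 / (n : ℝ)) • (w - φ j) :=
    finitoAvg_update φ j w (fun _ x => x)
  rw [finitoAvg_update φ j w f', em,
    finito_update_sum φ j w (fun i x => f i x - ⟪f' i x, x⟫)]
  have hd := finito_avg_des hn L f f' hdes (finitoAvg φ)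
    (finitoAvg φ + (1 / (n : ℝ)) • (w - φ j))
  have hc := hcomp j w (φ j)
  rw [add_sub_cancel_left] at hd
  obtain ⟨m, hm⟩ : ∃ m, m = finitoAvg φ := ⟨_, rfl⟩
  obtain ⟨p, hp⟩ : ∃ p, p = finitoAvg (fun i => f' i (φ i)) := ⟨_, rfl⟩
  obtain ⟨G, hG⟩ : ∃ G, G = finitoAvg (fun i => f' i (finitoAvg φ)) := ⟨_, rfl⟩
  rw [← hG, ← hm] at hd
  rw [← hG, ← hm, ← hp]
  obtain ⟨δ, hδ⟩ : ∃ δ, δ = w - φ j := ⟨_, rfl⟩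
  obtain ⟨g, hg⟩ : ∃ g, g = f' j w - f' j (φ j) := ⟨_, rfl⟩
  obtain ⟨r, hr⟩ : ∃ r, r = 1 / (n : ℝ) := ⟨_, rfl⟩
  rw [← hδ, ← hr] at hd
  rw [← hδ, ← hg] at hc
  rw [← hδ, ← hg, ← hr]
  generalize r * ∑ i, f i (m + r • δ) = F1 at *
  generalize r * ∑ i, f i m = F0 at *
  generalize ∑ i, (f i (φ i) - ⟪f' i (φ i), φ i⟫) = S at *
  have e4 : f' j w = f' j (φ j) + g := by rw [hg]; abel
  have e5 : φ j = w - δ := by rw [hδ]; abel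
  rw [e4]
  have e6 : ⟪f' j (φ j), φ j⟫ = ⟪f' j (φ j), w - δ⟫ := by rw [← e5]
  rw [e6]
  generalize f' j (φ j) = a at *
  generalize f j (φ j) = b at *
  generalize f j w = b' at *
  simp only [← real_inner_self_eq_norm_sq, inner_add_left, inner_sub_left, inner_sub_right,
    inner_add_right, inner_smul_left, inner_smul_right, RCLike.conj_to_real] at hd hc ⊢
  rw [real_inner_comm p g]
  have hrn : (n : ℝ) * r = 1 := by rw [hr]; field_simp
  have hr0 : 0 ≤ r := by rw [hr]; positivity
  have hc2 := mul_le_mul_of_nonneg_left hc hr0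
  have hd2 := mul_le_mul_of_nonneg_left hd hn0.le
  have hr2 : (n : ℝ) * r ^ 2 = r := by rw [pow_two, ← mul_assoc, hrn, one_mul]
  linear_combination hd2 + hc2
    + (-(b' - b - ⟪a, δ⟫ - ⟪g, w⟫) - ⟪p, δ⟫ - ⟪g, m⟫ + 2 * c * ⟪p, g⟫ + ⟪G, δ⟫
        + (1 - τ) * (b' - b - ⟪a, δ⟫)) * hrn
    + (-⟪g, δ⟫ + c * ⟪g, g⟫ + L / 2 * ⟪δ, δ⟫) * hr2

lemma finito_contract {n : ℕ} (hn : 0 < n) (L μ α c : ℝ) (hμ : 0 < μ) (hα : 2 ≤ α)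
    (hcdef : c = 1 / (α * μ) * (1 - 1 / (2 * α)))
    (f : Fin n → E → ℝ) (f' : Fin n → E → E)
    (hdes : ∀ i x y, f i y ≤ f i x + ⟪f' i x, y - x⟫ + L / 2 * ‖y - x‖ ^ 2)
    (hsc : ∀ i x y, f i x ≥ f i y + ⟪f' i y, x - y⟫ + μ / 2 * ‖x - y‖ ^ 2)
    (hcomp : ∀ i x y, L / 2 * ‖x - y‖ ^ 2 + c * ‖f' i x - f' i y‖ ^ 2
      - ⟪f' i x - f' i y, x - y⟫ ≤ n * ((1 - 1 / α) * (f i x - f i y - ⟪f' i y, x - y⟫)))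
    (φ : Fin n → E) (w : E)
    (hw : w = finitoAvg φ - (1 / (α * μ)) • finitoAvg (fun i => f' i (φ i))) :
    ∑ j, finitoT c f f' (Function.update φ j w) ≤ n * ((1 - 1 / (α * n)) * finitoT c f f' φ) := by
  have hn0 : (0 : ℝ) < n := by positivity
  have h := Finset.sum_le_sum (fun j (_ : j ∈ Finset.univ) =>
    finito_step_one hn L c (1 / α) f f' hdes hcomp φ w j)
  have hs1 := finito_avg_sc hn μ f f' hsc (finitoAvg φ) w
  have hs2 := finito_avg_sc hn μ f f' hsc w (finitoAvg φ)
  have eδ : ∑ j, (w - φ j) = (n : ℝ) • (w - finitoAvg φ) := by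
    rw [Finset.sum_sub_distrib, finito_sum_eq hn φ, smul_sub]
    simp [Nat.cast_smul_eq_nsmul]
  have eg : ∑ j, (f' j w - f' j (φ j))
      = (n : ℝ) • (finitoAvg (fun i => f' i w) - finitoAvg (fun i => f' i (φ i))) := by
    rw [Finset.sum_sub_distrib, finito_sum_eq hn (fun i => f' i (φ i)),
      finito_sum_eq hn (fun i => f' i w), smul_sub]
  have eD : ∑ j, (f j w - f j (φ j) - ⟪f' j (φ j), w - φ j⟫)
      = ∑ j, f j w - ∑ i, (f i (φ i) - ⟪f' i (φ i), φ i⟫)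
        - n * ⟪finitoAvg (fun i => f' i (φ i)), w⟫ := by
    rw [← RCLike.conj_to_real (x := (n : ℝ)), ← inner_smul_left (𝕜 := ℝ),
      ← finito_sum_eq hn (fun i => f' i (φ i)), sum_inner, ← Finset.sum_sub_distrib,
      ← Finset.sum_sub_distrib]
    refine Finset.sum_congr rfl fun i _ => ?_
    rw [inner_sub_right]; ring
  rw [Finset.sum_add_distrib, Finset.sum_add_distrib, Finset.sum_sub_distrib, ← inner_sum,
    ← Finset.mul_sum, ← Finset.mul_sum, ← sum_inner, ← Finset.mul_sum, ← inner_sum,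
    eδ, eg, eD, Finset.sum_sub_distrib] at h
  simp only [Finset.sum_const, Finset.card_univ, Fintype.card_fin, nsmul_eq_mul] at h
  generalize ∑ j, finitoT c f f' (Function.update φ j w) = T1 at *
  unfold finitoT at h ⊢
  have eF : ∑ j, f j w = n * ((1 / (n : ℝ)) * ∑ j, f j w) := by field_simp
  rw [eF] at h
  generalize ∑ i, (f i (φ i) - ⟪f' i (φ i), φ i⟫) = S at *
  obtain ⟨m, hm⟩ : ∃ m, m = finitoAvg φ := ⟨_, rfl⟩
  rw [← hm] at h hs1 hs2 hw ⊢
  generalize finitoAvg (fun i => f' i (φ i)) = p at *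
  generalize finitoAvg (fun i => f' i m) = Gm at *
  generalize finitoAvg (fun i => f' i w) = Gw at *
  generalize (1 / (n : ℝ)) * ∑ i, f i m = Fm at *
  generalize (1 / (n : ℝ)) * ∑ i, f i w = Fw at *
  obtain ⟨τ, hτ⟩ : ∃ τ, τ = 1 / α := ⟨_, rfl⟩
  obtain ⟨t, ht⟩ : ∃ t, t = 1 / (α * μ) := ⟨_, rfl⟩
  have hα0 : 0 < α := by linarith
  have htμ : μ * t = τ := by rw [ht, hτ]; field_simp
  have hcc : c = t * (1 - τ / 2) := by rw [hcdef, ht, hτ]; ring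
  have hτ0 : 0 ≤ τ := by rw [hτ]; positivity
  have hτ1 : 0 ≤ 1 - τ := by
    have : 1 / α ≤ 1 / 2 := one_div_le_one_div_of_le (by norm_num) hα
    linarith
  rw [← ht] at hw
  have ew : w - m = -(t • p) := by rw [hw]; abel
  have ew' : m - w = t • p := by rw [hw]; abel
  have ewp : ⟪p, w⟫ = ⟪p, m⟫ - t * ⟪p, p⟫ := by rw [hw, inner_sub_right, inner_smul_right]
  rw [ew'] at hs1
  rw [ew] at hs2 h
  rw [← hτ, ewp] at h
  simp only [← real_inner_self_eq_norm_sq, inner_sub_left, inner_sub_right, inner_neg_left,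
    inner_smul_left, inner_smul_right, inner_neg_right, RCLike.conj_to_real,
    real_inner_comm Gw p] at hs1 hs2 h ⊢
  have g1 := mul_le_mul_of_nonneg_left hs2.le hτ0
  have g2 := mul_le_mul_of_nonneg_left (add_le_add hs1.le hs2.le) hτ1
  have erS : (n : ℝ) * (1 / n * S) = S := by field_simp
  have key : n * (T1 - n * (Fm - 1 / n * S - ⟪p, m⟫ + c * ⟪p, p⟫))
      ≤ n * (-τ * (Fm - 1 / n * S - ⟪p, m⟫ + c * ⟪p, p⟫)) := by
    have g3 := mul_le_mul_of_nonneg_left (add_le_add g1 g2) hn0.le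
    rw [hcc] at h ⊢
    linear_combination h + g3 - τ * erS - n * ⟪p, p⟫ * t * (1 - τ / 2) * htμ
  have key2 := le_of_mul_le_mul_left key hn0
  have e7 : (n : ℝ) * (1 - 1 / (α * n)) = n - τ := by rw [hτ]; field_simp
  rw [← mul_assoc, e7]
  linarith

lemma finito_lower {n : ℕ} (hn : 0 < n) (μ : ℝ) (hμ : 0 < μ)
    (f : Fin n → E → ℝ) (f' : Fin n → E → E)
    (hsc : ∀ i x y, f i x ≥ f i y + ⟪f' i y, x - y⟫ + μ / 2 * ‖x - y‖ ^ 2)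
    (φ : Fin n → E) (z : E) :
    (1 / (n : ℝ)) * ∑ i, (f i (φ i) - ⟪f' i (φ i), φ i⟫)
      + ⟪finitoAvg (fun i => f' i (φ i)), z⟫ + μ / 2 * ‖z - finitoAvg φ‖ ^ 2
      ≤ (1 / (n : ℝ)) * ∑ i, f i z := by
  have hn0 : (0 : ℝ) < n := by positivity
  have h1 : ∀ i, (f i (φ i) - ⟪f' i (φ i), φ i⟫) + ⟪f' i (φ i), z⟫
      + (μ / 2 * ‖z - finitoAvg φ‖ ^ 2 + μ * ⟪z - finitoAvg φ, finitoAvg φ - φ i⟫) ≤ f i z := by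
    intro i
    have h2 := hsc i z (φ i)
    have e : z - φ i = (z - finitoAvg φ) + (finitoAvg φ - φ i) := by abel
    have h3 : ‖z - φ i‖ ^ 2 ≥ ‖z - finitoAvg φ‖ ^ 2
        + 2 * ⟪z - finitoAvg φ, finitoAvg φ - φ i⟫ := by
      rw [e, norm_add_sq_real]
      nlinarith [sq_nonneg ‖finitoAvg φ - φ i‖]
    rw [inner_sub_right] at h2
    have h4 := mul_le_mul_of_nonneg_left h3 (by positivity : 0 ≤ μ / 2)
    linarith
  have h := Finset.sum_le_sum (fun i (_ : i ∈ Finset.univ) => h1 i)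
  have e0 : ∑ i, (finitoAvg φ - φ i) = 0 := by
    rw [Finset.sum_sub_distrib, finito_sum_eq hn φ]
    simp [Nat.cast_smul_eq_nsmul]
  rw [Finset.sum_add_distrib, Finset.sum_add_distrib, Finset.sum_add_distrib, ← sum_inner,
    ← Finset.mul_sum Finset.univ _ μ, ← inner_sum, e0, inner_zero_right,
    finito_sum_eq hn (fun i => f' i (φ i)), inner_smul_left, RCLike.conj_to_real] at h
  simp only [Finset.sum_const, Finset.card_univ, Fintype.card_fin, nsmul_eq_mul] at h
  have h2 := mul_le_mul_of_nonneg_left h (by positivity : (0 : ℝ) ≤ 1 / n)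
  have e : (1 / (n : ℝ)) * n = 1 := by field_simp
  linear_combination h2 - (⟪finitoAvg (fun i => f' i (φ i)), z⟫
    + μ / 2 * ‖z - finitoAvg φ‖ ^ 2) * e

lemma finito_final {n : ℕ} (hn : 0 < n) (μ α c : ℝ) (hμ : 0 < μ) (hα : 2 ≤ α)
    (hcdef : c = 1 / (α * μ) * (1 - 1 / (2 * α)))
    (f : Fin n → E → ℝ) (f' : Fin n → E → E)
    (hsc : ∀ i x y, f i x ≥ f i y + ⟪f' i y, x - y⟫ + μ / 2 * ‖x - y‖ ^ 2)
    (φ : Fin n → E) (z : E) :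
    (1 / (n : ℝ)) * ∑ i, f i (finitoAvg φ) - (1 / (n : ℝ)) * ∑ i, f i z
      ≤ α * finitoT c f f' φ := by
  have h1 := finito_lower hn μ hμ f f' hsc φ z
  have h2 := finito_lower hn μ hμ f f' hsc φ (finitoAvg φ)
  unfold finitoT
  rw [sub_self, norm_zero] at h2
  generalize (1 / (n : ℝ)) * ∑ i, (f i (φ i) - ⟪f' i (φ i), φ i⟫) = S at *
  generalize (1 / (n : ℝ)) * ∑ i, f i (finitoAvg φ) = Fm at *
  generalize (1 / (n : ℝ)) * ∑ i, f i z = Fz at *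
  generalize finitoAvg (fun i => f' i (φ i)) = p at *
  generalize finitoAvg φ = m at *
  have hα0 : 0 < α := by linarith
  have h3 : 0 ≤ ‖p + μ • (z - m)‖ ^ 2 := sq_nonneg _
  rw [norm_add_sq_real, norm_smul, inner_smul_right, mul_pow, Real.norm_eq_abs, sq_abs,
    inner_sub_right] at h3
  have h4 : 0 ≤ 1 / (2 * μ) * ‖p‖ ^ 2 + (⟪p, z⟫ - ⟪p, m⟫) + μ / 2 * ‖z - m‖ ^ 2 := by
    have := mul_nonneg (by positivity : 0 ≤ 1 / (2 * μ)) h3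
    have e : 1 / (2 * μ) * (‖p‖ ^ 2 + 2 * (μ * (⟪p, z⟫ - ⟪p, m⟫)) + μ ^ 2 * ‖z - m‖ ^ 2)
      = 1 / (2 * μ) * ‖p‖ ^ 2 + (⟪p, z⟫ - ⟪p, m⟫) + μ / 2 * ‖z - m‖ ^ 2 := by field_simp
    rwa [e] at this
  have h5 : 1 / (2 * μ) ≤ α * c := by
    have e : α * c = 1 / (2 * μ) * (2 - 1 / α) := by rw [hcdef]; field_simp
    rw [e]
    have : 1 / α ≤ 1 / 2 := one_div_le_one_div_of_le (by norm_num) hα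
    have h0 : 0 ≤ 1 / (2 * μ) := by positivity
    nlinarith
  have h6 := mul_le_mul_of_nonneg_right h5 (sq_nonneg ‖p‖)
  have h7 : 0 ≤ (α - 1) * (Fm - S - ⟪p, m⟫) :=
    mul_nonneg (by linarith) (by linarith)
  linarith

end FinitoMain

lemma finitoIter_congr (d n : ℕ) (α μ : ℝ)
    (f' : Fin n → EuclideanSpace ℝ (Fin d) → EuclideanSpace ℝ (Fin d))
    (φ0 : Fin n → EuclideanSpace ℝ (Fin d)) (js js' : ℕ → Fin n) (k : ℕ)
    (h : ∀ t < k, js t = js' t) :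
    finitoIter d n α μ f' φ0 js k = finitoIter d n α μ f' φ0 js' k := by
  induction k with
  | zero => rfl
  | succ k ih =>
    simp only [finitoIter]
    rw [ih (fun t ht => h t (by omega)), h k (by omega)]

lemma finito_sum_succ (d n k : ℕ) (hn : 0 < n) (α μ : ℝ)
    (f' : Fin n → EuclideanSpace ℝ (Fin d) → EuclideanSpace ℝ (Fin d))
    (φ0 : Fin n → EuclideanSpace ℝ (Fin d))
    (T : (Fin n → EuclideanSpace ℝ (Fin d)) → ℝ) :
    ∑ js : Fin (k + 1) → Fin n, T (finitoIter d n α μ f' φ0 (extSeq hn js) (k + 1))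
      = ∑ js : Fin k → Fin n, ∑ j : Fin n,
          T (Function.update (finitoIter d n α μ f' φ0 (extSeq hn js) k) j
            (finitoW d n α μ f' (finitoIter d n α μ f' φ0 (extSeq hn js) k))) := by
  rw [← (Fin.snocEquiv (fun _ => Fin n)).sum_comp, Fintype.sum_prod_type, Finset.sum_comm]
  refine Finset.sum_congr rfl fun js _ => Finset.sum_congr rfl fun j _ => ?_
  have h1 : finitoIter d n α μ f' φ0
      (extSeq hn ((Fin.snocEquiv (fun _ => Fin n)) (j, js))) k
      = finitoIter d n α μ f' φ0 (extSeq hn js) k := by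
    apply finitoIter_congr
    intro t ht
    have ht' : t < k + 1 := by omega
    simp [extSeq, ht, ht', Fin.snocEquiv, Fin.snoc]
  have h2 : extSeq hn ((Fin.snocEquiv (fun _ => Fin n)) (j, js)) k = j := by
    simp [extSeq, Fin.snocEquiv, Fin.snoc]
  simp only [finitoIter]
  rw [h1, h2]

theorem finito_convergence (d n k : ℕ) (hn : 0 < n) (μ L α β : ℝ)
    (hμ : 0 < μ) (hμL : μ ≤ L) (hα : 2 ≤ α) (hβ : 2 ≤ β)
    (hcond : 2 / α - 1 / α ^ 2 - β + β / α ≤ 0)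
    (hbig : β * L / μ ≤ (n : ℝ))
    (f : Fin n → EuclideanSpace ℝ (Fin d) → ℝ)
    (f' : Fin n → EuclideanSpace ℝ (Fin d) → EuclideanSpace ℝ (Fin d))
    (hgrad : ∀ i x, HasGradientAt (f i) (f' i x) x)
    (hsmooth : ∀ i x y, ‖f' i x - f' i y‖ ≤ L * ‖x - y‖)
    (hsc : ∀ i x y, f i x ≥ f i y + ⟪f' i y, x - y⟫ + μ / 2 * ‖x - y‖ ^ 2)
    (φ0 wstar : EuclideanSpace ℝ (Fin d))
    (hstar : ∀ x, (1 / (n : ℝ)) * ∑ i, f i wstar ≤ (1 / (n : ℝ)) * ∑ i, f i x) :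
    (1 / (n : ℝ) ^ k) * (∑ js : Fin k → Fin n,
        (1 / (n : ℝ)) * ∑ i, f i ((1 / (n : ℝ)) •
          ∑ i', finitoIter d n α μ f' (fun _ => φ0) (extSeq hn js) k i'))
      - (1 / (n : ℝ)) * ∑ i, f i wstar
      ≤ (1 - 1 / (2 * α)) / μ * (1 - 1 / (α * n)) ^ k *
          ‖(1 / (n : ℝ)) • ∑ i, f' i φ0‖ ^ 2 := by
  have hn0 : (0 : ℝ) < n := by positivity
  have hα0 : 0 < α := by linarith
  have hdes := fun i => finito_descent L (f i) (f' i) (hgrad i) (hsmooth i)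
  obtain ⟨c, hc⟩ : ∃ c, c = 1 / (α * μ) * (1 - 1 / (2 * α)) := ⟨_, rfl⟩
  have hcomp := fun i => finito_component L μ α β n hμ hμL hα hβ hcond hbig (f i) (f' i)
    (hsmooth i) (hdes i) (hsc i)
  rw [← hc] at hcomp
  have hρ : 0 ≤ 1 - 1 / (α * n) := by
    have h1 : (1 : ℝ) ≤ n := by exact_mod_cast hn
    have : 1 / (α * n) ≤ 1 := by
      rw [div_le_one (by positivity)]
      nlinarith
    linarith
  have hW : ∀ φ, finitoW d n α μ f' φ
      = finitoAvg φ - (1 / (α * μ)) • finitoAvg (fun i => f' i (φ i)) := by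
    intro φ
    rw [finitoW, finitoAvg, finitoAvg, smul_smul]
    congr 2
    field_simp
  have hT : ∀ k : ℕ, (1 / (n : ℝ) ^ k) * (∑ js : Fin k → Fin n,
      finitoT c f f' (finitoIter d n α μ f' (fun _ => φ0) (extSeq hn js) k))
      ≤ (1 - 1 / (α * n)) ^ k * finitoT c f f' (fun _ => φ0) := by
    intro k
    induction k with
    | zero => simp [finitoIter]
    | succ k ih =>
      rw [finito_sum_succ]
      have h1 := Finset.sum_le_sum (fun (js : Fin k → Fin n) (_ : js ∈ Finset.univ) =>
        finito_contract hn L μ α c hμ hα hc f f' hdes hsc hcomp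
          (finitoIter d n α μ f' (fun _ => φ0) (extSeq hn js) k) _ (hW _))
      rw [← Finset.mul_sum, ← Finset.mul_sum] at h1
      have h2 := mul_le_mul_of_nonneg_left h1 (by positivity : 0 ≤ 1 / (n : ℝ) ^ (k + 1))
      refine h2.trans ?_
      have h3 := mul_le_mul_of_nonneg_left ih hρ
      have e : ∀ A : ℝ, 1 / (n : ℝ) ^ (k + 1) * (n * ((1 - 1 / (α * n)) * A))
          = (1 - 1 / (α * n)) * (1 / (n : ℝ) ^ k * A) := by
        intro A
        have : (n : ℝ) * (1 / (n : ℝ) ^ (k + 1)) = 1 / (n : ℝ) ^ k := by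
          rw [pow_succ]; field_simp
        rw [← this]; ring
      rw [e]
      refine h3.trans (le_of_eq ?_)
      ring
  have hT0 : finitoT c f f' (fun _ => φ0) = c * ‖(1 / (n : ℝ)) • ∑ i, f' i φ0‖ ^ 2 := by
    change _ = c * ‖finitoAvg (fun i => f' i φ0)‖ ^ 2
    unfold finitoT
    rw [finitoAvg_const hn, Finset.sum_sub_distrib, ← sum_inner,
      finito_sum_eq hn (fun i => f' i φ0), inner_smul_left, RCLike.conj_to_real]
    have : (1 / (n : ℝ)) * n = 1 := by field_simp
    linear_combination ⟪finitoAvg (fun i => f' i φ0), φ0⟫ * this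
  have hfin := Finset.sum_le_sum (fun (js : Fin k → Fin n) (_ : js ∈ Finset.univ) =>
    finito_final hn μ α c hμ hα hc f f' hsc
      (finitoIter d n α μ f' (fun _ => φ0) (extSeq hn js) k) wstar)
  rw [Finset.sum_sub_distrib, ← Finset.mul_sum Finset.univ _ α] at hfin
  simp only [Finset.sum_const, Finset.card_univ, Fintype.card_fun, Fintype.card_fin,
    nsmul_eq_mul, Nat.cast_pow] at hfin
  have h2 := mul_le_mul_of_nonneg_left hfin (by positivity : 0 ≤ 1 / (n : ℝ) ^ k)
  have h3 := mul_le_mul_of_nonneg_left (hT k) hα0.le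
  rw [hT0] at h3
  have e1 : 1 / (n : ℝ) ^ k * (n : ℝ) ^ k = 1 := by field_simp
  have e2 : α * c = (1 - 1 / (2 * α)) / μ := by rw [hc]; field_simp
  rw [← e2]
  simp only [finitoAvg] at h2
  linear_combination h2 + h3 + (1 / (n : ℝ) * ∑ i, f i wstar) * e1
end

section
/- Let n > 1. Initialize a table φ^0 with associated lower bound B^0 and its minimizer w^0, and run k Prox-Finito update steps, choosing the index at each step independently and uniformly at random from {1,…,n} (so E below is the average over all n^k index sequences). Then E[f(w^k) − f(w*)] ≤ (1 − μ/(μn + L − μ))^k · ((μn + L − μ)/μ) · [f(w*) − B^0(w^0)]. -/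
open scoped RealInnerProductSpace

/-- The strong-convexity lower bound `l_i` attached to table entry `φ i`. -/
noncomputable def pfL (d n : ℕ) (μ : ℝ)
    (f : Fin n → EuclideanSpace ℝ (Fin d) → ℝ)
    (f' : Fin n → EuclideanSpace ℝ (Fin d) → EuclideanSpace ℝ (Fin d))
    (φ : Fin n → EuclideanSpace ℝ (Fin d)) (i : Fin n)
    (x : EuclideanSpace ℝ (Fin d)) : ℝ :=
  f i (φ i) + ⟪f' i (φ i), x - φ i⟫ + μ / 2 * ‖x - φ i‖ ^ 2

/-- The global lower bound `B` associated with a table `φ`. -/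
noncomputable def pfB (d n : ℕ) (μ : ℝ)
    (f : Fin n → EuclideanSpace ℝ (Fin d) → ℝ)
    (f' : Fin n → EuclideanSpace ℝ (Fin d) → EuclideanSpace ℝ (Fin d))
    (φ : Fin n → EuclideanSpace ℝ (Fin d))
    (x : EuclideanSpace ℝ (Fin d)) : ℝ :=
  (1 / (n : ℝ)) * ∑ i, pfL d n μ f f' φ i x

/-- The minimizer of the global lower bound `B` associated with a table `φ`. -/
noncomputable def pfW (d n : ℕ) (μ : ℝ)
    (f' : Fin n → EuclideanSpace ℝ (Fin d) → EuclideanSpace ℝ (Fin d))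
    (φ : Fin n → EuclideanSpace ℝ (Fin d)) : EuclideanSpace ℝ (Fin d) :=
  (1 / (n : ℝ)) • ∑ i, φ i - (1 / (μ * n)) • ∑ i, f' i (φ i)

/-- The Prox-Finito table after `k` update steps with index sequence `js`, where
`z ψ j` gives the new table entry for an update of table `ψ` at index `j`. -/
noncomputable def pfIter (d n : ℕ)
    (z : (Fin n → EuclideanSpace ℝ (Fin d)) → Fin n → EuclideanSpace ℝ (Fin d))
    (φ0 : Fin n → EuclideanSpace ℝ (Fin d)) (js : ℕ → Fin n) :
    ℕ → Fin n → EuclideanSpace ℝ (Fin d)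
  | 0 => φ0
  | k + 1 =>
      Function.update (pfIter d n z φ0 js k) (js k)
        (z (pfIter d n z φ0 js k) (js k))

theorem pf_descent {d : ℕ} {L : ℝ} {g : EuclideanSpace ℝ (Fin d) → ℝ}
    {g' : EuclideanSpace ℝ (Fin d) → EuclideanSpace ℝ (Fin d)}
    (hgrad : ∀ x, HasGradientAt g (g' x) x)
    (hsmooth : ∀ x y, ‖g' x - g' y‖ ≤ L * ‖x - y‖) (x y : EuclideanSpace ℝ (Fin d)) :
    g y ≤ g x + ⟪g' x, y - x⟫ + L / 2 * ‖y - x‖ ^ 2 := by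
  set v := y - x with hv
  let h : ℝ → ℝ := fun t => g (x + t • v) - t * ⟪g' x, v⟫ - L / 2 * ‖v‖ ^ 2 * t ^ 2
  have hd : ∀ t, HasDerivAt h (⟪g' (x + t • v), v⟫ - ⟪g' x, v⟫ - L * ‖v‖ ^ 2 * t) t := by
    intro t
    have h1 : HasDerivAt (fun t : ℝ => x + t • v) v t := by
      simpa using ((hasDerivAt_id t).smul_const v).const_add x
    have h2 : HasDerivAt (fun t : ℝ => g (x + t • v)) ⟪g' (x + t • v), v⟫ t := by
      have := (hgrad (x + t • v)).hasFDerivAt.comp_hasDerivAt t h1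
      rw [InnerProductSpace.toDual_apply_apply] at this
      exact this
    have h3 : HasDerivAt (fun t : ℝ => t * ⟪g' x, v⟫) ⟪g' x, v⟫ t := by
      simpa using (hasDerivAt_id t).mul_const ⟪g' x, v⟫
    have h4 : HasDerivAt (fun t : ℝ => L / 2 * ‖v‖ ^ 2 * t ^ 2) (L * ‖v‖ ^ 2 * t) t := by
      exact ((hasDerivAt_pow 2 t).const_mul (L / 2 * ‖v‖ ^ 2)).congr_deriv
        (by push_cast; ring)
    exact (h2.sub h3).sub h4
  have hanti : AntitoneOn h (Set.Icc 0 1) := by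
    apply antitoneOn_of_deriv_nonpos (convex_Icc 0 1)
    · exact fun t _ => (hd t).continuousAt.continuousWithinAt
    · exact fun t _ => (hd t).differentiableAt.differentiableWithinAt
    · intro t ht
      rw [interior_Icc] at ht
      rw [(hd t).deriv, ← inner_sub_left]
      have h1 := real_inner_le_norm (g' (x + t • v) - g' x) v
      have h2 := hsmooth (x + t • v) x
      rw [add_sub_cancel_left, norm_smul, Real.norm_of_nonneg ht.1.le] at h2
      have h3 := mul_le_mul_of_nonneg_right h2 (norm_nonneg v)
      nlinarith
  have := hanti (Set.left_mem_Icc.2 zero_le_one) (Set.right_mem_Icc.2 zero_le_one) zero_le_one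
  simp only [h, one_smul, zero_smul, add_zero, hv, add_sub_cancel] at this
  simp only [hv]
  linarith

/-- Moreau envelope bound for a nonnegative smooth function. -/
theorem pf_envelope {d : ℕ} {M p : ℝ} (hM : 0 ≤ M) (hp : 0 < p)
    {g : EuclideanSpace ℝ (Fin d) → ℝ} (u : EuclideanSpace ℝ (Fin d))
    (z w : EuclideanSpace ℝ (Fin d)) (hpos : ∀ y, 0 ≤ g y)
    (hdesc : ∀ y, g y ≤ g z + ⟪u, y - z⟫ + M / 2 * ‖y - z‖ ^ 2) :
    p * g w ≤ (p + M) * (g z + p / 2 * ‖z - w‖ ^ 2) := by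
  have hline : ∀ t : ℝ, 0 ≤ g z - t * ‖u‖ ^ 2 + M / 2 * t ^ 2 * ‖u‖ ^ 2 := by
    intro t
    have h1 := hdesc (z - t • u)
    have h2 := hpos (z - t • u)
    have h3 : z - t • u - z = -(t • u) := by abel
    rw [h3, inner_neg_right, real_inner_smul_right, norm_neg, norm_smul, mul_pow,
      Real.norm_eq_abs, sq_abs, real_inner_self_eq_norm_sq] at h1
    linarith
  have hu : ‖u‖ ^ 2 ≤ 2 * M * g z := by
    rcases hM.eq_or_lt with h0 | h0
    · subst h0
      by_contra hcon
      have hu : 0 < ‖u‖ ^ 2 := by linarith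
      have := hline ((g z + 1) / ‖u‖ ^ 2)
      rw [div_mul_cancel₀ _ hu.ne'] at this
      linarith
    · have := hline (1 / M)
      have h2 : g z - 1 / M * ‖u‖ ^ 2 + M / 2 * (1 / M) ^ 2 * ‖u‖ ^ 2
          = (2 * M * g z - ‖u‖ ^ 2) / (2 * M) := by
        field_simp; ring
      rw [h2] at this
      have h5 := mul_nonneg this (by positivity : 0 ≤ 2 * M)
      rw [div_mul_cancel₀ _ (by positivity)] at h5
      linarith
  have h1 := hdesc w
  have h2 : ‖u - p • (w - z)‖ ^ 2 = ‖u‖ ^ 2 - 2 * (p * ⟪u, w - z⟫) + p ^ 2 * ‖w - z‖ ^ 2 := by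
    rw [norm_sub_sq_real, real_inner_smul_right, norm_smul, mul_pow, Real.norm_eq_abs, sq_abs]
  have h3 := sq_nonneg ‖u - p • (w - z)‖
  rw [norm_sub_rev z w]
  have h4 := mul_le_mul_of_nonneg_left h1 hp.le
  nlinarith

theorem pfL_expand (d n : ℕ) (μ : ℝ)
    (f : Fin n → EuclideanSpace ℝ (Fin d) → ℝ)
    (f' : Fin n → EuclideanSpace ℝ (Fin d) → EuclideanSpace ℝ (Fin d))
    (φ : Fin n → EuclideanSpace ℝ (Fin d)) (i : Fin n)
    (w x : EuclideanSpace ℝ (Fin d)) :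
    pfL d n μ f f' φ i x = pfL d n μ f f' φ i w
      + ⟪f' i (φ i) + μ • (w - φ i), x - w⟫ + μ / 2 * ‖x - w‖ ^ 2 := by
  unfold pfL
  have h1 : x - φ i = (x - w) + (w - φ i) := by abel
  rw [h1, norm_add_sq_real, inner_add_right, inner_add_left, real_inner_smul_left,
    real_inner_comm (x - w) (w - φ i)]
  ring

theorem pfL_sum_expand (d n : ℕ) (μ : ℝ)
    (f : Fin n → EuclideanSpace ℝ (Fin d) → ℝ)
    (f' : Fin n → EuclideanSpace ℝ (Fin d) → EuclideanSpace ℝ (Fin d))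
    (φ : Fin n → EuclideanSpace ℝ (Fin d)) (s : Finset (Fin n))
    (w x : EuclideanSpace ℝ (Fin d)) :
    ∑ i ∈ s, pfL d n μ f f' φ i x = ∑ i ∈ s, pfL d n μ f f' φ i w
      + ⟪∑ i ∈ s, (f' i (φ i) + μ • (w - φ i)), x - w⟫ + s.card * (μ / 2 * ‖x - w‖ ^ 2) := by
  rw [sum_inner, ← nsmul_eq_mul, ← Finset.sum_const, ← Finset.sum_add_distrib,
    ← Finset.sum_add_distrib]
  exact Finset.sum_congr rfl fun i _ => pfL_expand d n μ f f' φ i w x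

theorem pfW_iff (d n : ℕ) (hn : 0 < n) (μ : ℝ) (hμ : 0 < μ)
    (f' : Fin n → EuclideanSpace ℝ (Fin d) → EuclideanSpace ℝ (Fin d))
    (φ : Fin n → EuclideanSpace ℝ (Fin d)) (w : EuclideanSpace ℝ (Fin d)) :
    ∑ i, (f' i (φ i) + μ • (w - φ i)) = 0 ↔ pfW d n μ f' φ = w := by
  have hn' : (n : ℝ) ≠ 0 := by positivity
  have key : ∑ i, (f' i (φ i) + μ • (w - φ i)) = (μ * n) • (w - pfW d n μ f' φ) := by
    unfold pfW
    rw [Finset.sum_add_distrib, ← Finset.smul_sum, Finset.sum_sub_distrib, Finset.sum_const,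
      Finset.card_univ, Fintype.card_fin, ← Nat.cast_smul_eq_nsmul ℝ]
    simp only [smul_sub, smul_smul]
    have e1 : μ * n * (1 / n) = μ := by field_simp
    have e2 : μ * n * (1 / (μ * n)) = 1 := by field_simp
    rw [e1, e2, one_smul]
    abel
  rw [key, smul_eq_zero, sub_eq_zero]
  constructor
  · rintro (h | h)
    · exact absurd h (by positivity)
    · exact h.symm
  · exact fun h => Or.inr h.symm

theorem pfB_expand (d n : ℕ) (hn : 0 < n) (μ : ℝ) (hμ : 0 < μ)
    (f : Fin n → EuclideanSpace ℝ (Fin d) → ℝ)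
    (f' : Fin n → EuclideanSpace ℝ (Fin d) → EuclideanSpace ℝ (Fin d))
    (φ : Fin n → EuclideanSpace ℝ (Fin d)) (x : EuclideanSpace ℝ (Fin d)) :
    pfB d n μ f f' φ x = pfB d n μ f f' φ (pfW d n μ f' φ)
      + μ / 2 * ‖x - pfW d n μ f' φ‖ ^ 2 := by
  have hn' : (n : ℝ) ≠ 0 := by positivity
  unfold pfB
  rw [pfL_sum_expand d n μ f f' φ Finset.univ (pfW d n μ f' φ) x,
    (pfW_iff d n hn μ hμ f' φ _).2 rfl, inner_zero_left, Finset.card_univ, Fintype.card_fin]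
  field_simp
  ring

theorem pfB_le (d n : ℕ) (μ : ℝ) (hμ : 0 < μ) (hn : 0 < n)
    (f : Fin n → EuclideanSpace ℝ (Fin d) → ℝ)
    (f' : Fin n → EuclideanSpace ℝ (Fin d) → EuclideanSpace ℝ (Fin d))
    (hsc : ∀ i x y, f i x ≥ f i y + ⟪f' i y, x - y⟫ + μ / 2 * ‖x - y‖ ^ 2)
    (φ : Fin n → EuclideanSpace ℝ (Fin d)) (x : EuclideanSpace ℝ (Fin d)) :
    pfB d n μ f f' φ (pfW d n μ f' φ) ≤ (1 / (n : ℝ)) * ∑ i, f i x := by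
  have h1 := pfB_expand d n hn μ hμ f f' φ x
  have h2 : pfB d n μ f f' φ x ≤ (1 / (n : ℝ)) * ∑ i, f i x := by
    unfold pfB
    gcongr with i
    exact hsc i x (φ i)
  have : 0 ≤ μ / 2 * ‖x - pfW d n μ f' φ‖ ^ 2 := by positivity
  linarith

theorem pf_step (d n : ℕ) (hn : 0 < n) (μ L : ℝ)
    (hμ : 0 < μ) (hμL : μ ≤ L)
    (f : Fin n → EuclideanSpace ℝ (Fin d) → ℝ)
    (f' : Fin n → EuclideanSpace ℝ (Fin d) → EuclideanSpace ℝ (Fin d))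
    (hgrad : ∀ i x, HasGradientAt (f i) (f' i x) x)
    (hsmooth : ∀ i x y, ‖f' i x - f' i y‖ ≤ L * ‖x - y‖)
    (hsc : ∀ i x y, f i x ≥ f i y + ⟪f' i y, x - y⟫ + μ / 2 * ‖x - y‖ ^ 2)
    (ψ : Fin n → EuclideanSpace ℝ (Fin d)) (j : Fin n) (z : EuclideanSpace ℝ (Fin d))
    (hz : ∀ (y : EuclideanSpace ℝ (Fin d)),
      (1 / (n : ℝ)) * f j z
          + (1 / (n : ℝ)) * ∑ i ∈ Finset.univ.erase j, pfL d n μ f f' ψ i z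
        ≤ (1 / (n : ℝ)) * f j y
          + (1 / (n : ℝ)) * ∑ i ∈ Finset.univ.erase j, pfL d n μ f f' ψ i y) :
    pfB d n μ f f' ψ (pfW d n μ f' ψ)
      + μ / (μ * n + L - μ) * (f j (pfW d n μ f' ψ) - pfL d n μ f f' ψ j (pfW d n μ f' ψ))
    ≤ pfB d n μ f f' (Function.update ψ j z) (pfW d n μ f' (Function.update ψ j z)) := by
  have hn0 : (0 : ℝ) < n := by positivity
  have hn1 : (1 : ℝ) ≤ n := by exact_mod_cast hn
  have hdesc := pf_descent (hgrad j) (hsmooth j)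
  set G := f' j z + ∑ i ∈ Finset.univ.erase j, (f' i (ψ i) + μ • (z - ψ i)) with hG
  -- first order optimality
  have hG0 : G = 0 := by
    set m : ℝ := ((Finset.univ.erase j).card : ℝ) with hm
    set C : ℝ := L / 2 + m * (μ / 2) with hC
    have hCpos : 0 < C := by
      have : 0 ≤ m * (μ / 2) := by positivity
      have : 0 < L := by linarith
      rw [hC]; linarith
    have h1 := hz (z - (1 / (2 * C)) • G)
    rw [← mul_add, ← mul_add] at h1
    have h1 := le_of_mul_le_mul_left h1 (by positivity)
    rw [pfL_sum_expand d n μ f f' ψ _ z (z - (1 / (2 * C)) • G)] at h1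
    have h2 := hdesc z (z - (1 / (2 * C)) • G)
    have h3 : z - (1 / (2 * C)) • G - z = -((1 / (2 * C)) • G) := by abel
    rw [h3] at h1 h2
    have h4 : ⟪f' j z, -((1 / (2 * C)) • G)⟫
        + ⟪∑ i ∈ Finset.univ.erase j, (f' i (ψ i) + μ • (z - ψ i)), -((1 / (2 * C)) • G)⟫
        = - (1 / (2 * C)) * ‖G‖ ^ 2 := by
      rw [← inner_add_left, ← hG, inner_neg_right, real_inner_smul_right,
        real_inner_self_eq_norm_sq]
      ring
    have h5 : ‖-((1 / (2 * C)) • G)‖ ^ 2 = (1 / (2 * C)) ^ 2 * ‖G‖ ^ 2 := by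
      rw [norm_neg, norm_smul, mul_pow, Real.norm_eq_abs, sq_abs]
    rw [h5] at h1 h2
    have h6 : 0 ≤ - (1 / (2 * C)) * ‖G‖ ^ 2 + C * ((1 / (2 * C)) ^ 2 * ‖G‖ ^ 2) := by
      rw [← h4]
      have : C * ((1 / (2 * C)) ^ 2 * ‖G‖ ^ 2) = L / 2 * ((1 / (2 * C)) ^ 2 * ‖G‖ ^ 2)
        + m * (μ / 2 * ((1 / (2 * C)) ^ 2 * ‖G‖ ^ 2)) := by
        generalize (1 / (2 * C)) ^ 2 * ‖G‖ ^ 2 = q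
        rw [hC]; ring
      rw [this]
      linarith
    have h7 : - (1 / (2 * C)) * ‖G‖ ^ 2 + C * ((1 / (2 * C)) ^ 2 * ‖G‖ ^ 2)
        = - (1 / (4 * C)) * ‖G‖ ^ 2 := by
      field_simp; ring
    rw [h7] at h6
    have h8 : 0 < 1 / (4 * C) := by positivity
    have h9 : ‖G‖ ^ 2 = 0 := by nlinarith [sq_nonneg ‖G‖]
    exact norm_eq_zero.1 (pow_eq_zero_iff two_ne_zero |>.1 h9)
  have hW : pfW d n μ f' (Function.update ψ j z) = z := by
    rw [← pfW_iff d n hn μ hμ, ← Finset.add_sum_erase _ _ (Finset.mem_univ j), ← hG0, hG]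
    congr 1
    · simp
    · refine Finset.sum_congr rfl fun i hi => ?_
      rw [Function.update_of_ne (Finset.ne_of_mem_erase hi)]
  have hBnew : pfB d n μ f f' (Function.update ψ j z) z
      = pfB d n μ f f' ψ z + (1 / n) * (f j z - pfL d n μ f f' ψ j z) := by
    unfold pfB
    rw [← Finset.add_sum_erase _ _ (Finset.mem_univ j),
      ← Finset.add_sum_erase _ (fun i => pfL d n μ f f' ψ i z) (Finset.mem_univ j)]
    have h1 : pfL d n μ f f' (Function.update ψ j z) j z = f j z := by
      simp [pfL]
    have h2 : ∑ i ∈ Finset.univ.erase j, pfL d n μ f f' (Function.update ψ j z) i z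
        = ∑ i ∈ Finset.univ.erase j, pfL d n μ f f' ψ i z := by
      refine Finset.sum_congr rfl fun i hi => ?_
      unfold pfL
      rw [Function.update_of_ne (Finset.ne_of_mem_erase hi)]
    rw [h1, h2]
    ring
  rw [hW, hBnew, pfB_expand d n hn μ hμ f f' ψ z]
  set w := pfW d n μ f' ψ
  have henv := pf_envelope (M := L - μ) (p := n * μ) (by linarith) (by positivity)
    (g := fun x => f j x - pfL d n μ f f' ψ j x) (f' j z - (f' j (ψ j) + μ • (z - ψ j))) z w
    (fun y => sub_nonneg.2 (hsc j y (ψ j)))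
    (by
      intro y
      have h1 := hdesc z y
      have h2 := pfL_expand d n μ f f' ψ j z y
      simp only [inner_sub_left]
      rw [h2]
      linarith)
  have hD : 0 < μ * n + L - μ := by nlinarith
  have h1 : μ / (μ * n + L - μ) * (f j w - pfL d n μ f f' ψ j w)
      = (1 / n) * ((n * μ * (f j w - pfL d n μ f f' ψ j w)) / (μ * n + L - μ)) := by
    field_simp
  have h2 : μ / 2 * ‖z - w‖ ^ 2 + 1 / n * (f j z - pfL d n μ f f' ψ j z)
      = (1 / n) * (f j z - pfL d n μ f f' ψ j z + n * μ / 2 * ‖z - w‖ ^ 2) := by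
    field_simp
    ring
  rw [add_assoc, h1, h2]
  gcongr
  rw [div_le_iff₀ hD]
  calc _ ≤ _ := henv
    _ = _ := by ring

theorem pfIter_congr (d n : ℕ)
    (z : (Fin n → EuclideanSpace ℝ (Fin d)) → Fin n → EuclideanSpace ℝ (Fin d))
    (φ0 : Fin n → EuclideanSpace ℝ (Fin d)) (a b : ℕ → Fin n) (k : ℕ)
    (h : ∀ t, t < k → a t = b t) : pfIter d n z φ0 a k = pfIter d n z φ0 b k := by
  induction k with
  | zero => rfl
  | succ k ih =>
    have h1 := ih fun t ht => h t (by omega)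
    simp only [pfIter]
    rw [h1, h k (by omega)]

theorem pfIter_snoc (d n : ℕ) (hn : 0 < n)
    (z : (Fin n → EuclideanSpace ℝ (Fin d)) → Fin n → EuclideanSpace ℝ (Fin d))
    (φ0 : Fin n → EuclideanSpace ℝ (Fin d)) (k : ℕ) (js : Fin k → Fin n) (j : Fin n) :
    pfIter d n z φ0 (extSeq hn (Fin.snoc (α := fun _ => Fin n) js j)) (k + 1)
      = Function.update (pfIter d n z φ0 (extSeq hn js) k) j
        (z (pfIter d n z φ0 (extSeq hn js) k) j) := by
  have h1 : pfIter d n z φ0 (extSeq hn (Fin.snoc (α := fun _ => Fin n) js j)) k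
      = pfIter d n z φ0 (extSeq hn js) k := by
    apply pfIter_congr
    intro t ht
    simp [extSeq, Fin.snoc, ht, Nat.lt_succ_of_lt ht]
  have h2 : extSeq hn (Fin.snoc (α := fun _ => Fin n) js j) k = j := by
    simp [extSeq, Fin.snoc]
  simp only [pfIter]
  rw [h1, h2]

theorem pf_sum_snoc {n k : ℕ} (F : (Fin (k + 1) → Fin n) → ℝ) :
    ∑ js, F js = ∑ js : Fin k → Fin n, ∑ j : Fin n, F (Fin.snoc (α := fun _ => Fin n) js j) := by
  rw [Finset.sum_comm, ← Fintype.sum_prod_type']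
  exact (Equiv.sum_comp (Fin.snocEquiv (fun _ : Fin (k + 1) => Fin n)) F).symm

theorem prox_finito_convergence (d n k : ℕ) (hn : 1 < n) (μ L : ℝ)
    (hμ : 0 < μ) (hμL : μ ≤ L)
    (f : Fin n → EuclideanSpace ℝ (Fin d) → ℝ)
    (f' : Fin n → EuclideanSpace ℝ (Fin d) → EuclideanSpace ℝ (Fin d))
    (hgrad : ∀ i x, HasGradientAt (f i) (f' i x) x)
    (hsmooth : ∀ i x y, ‖f' i x - f' i y‖ ≤ L * ‖x - y‖)
    (hsc : ∀ i x y, f i x ≥ f i y + ⟪f' i y, x - y⟫ + μ / 2 * ‖x - y‖ ^ 2)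
    (wstar : EuclideanSpace ℝ (Fin d))
    (hstar : ∀ x, (1 / (n : ℝ)) * ∑ i, f i wstar ≤ (1 / (n : ℝ)) * ∑ i, f i x)
    (φ0 : Fin n → EuclideanSpace ℝ (Fin d))
    (z : (Fin n → EuclideanSpace ℝ (Fin d)) → Fin n → EuclideanSpace ℝ (Fin d))
    (hz : ∀ ψ (j : Fin n) (y : EuclideanSpace ℝ (Fin d)),
      (1 / (n : ℝ)) * f j (z ψ j)
          + (1 / (n : ℝ)) * ∑ i ∈ Finset.univ.erase j, pfL d n μ f f' ψ i (z ψ j)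
        ≤ (1 / (n : ℝ)) * f j y
          + (1 / (n : ℝ)) * ∑ i ∈ Finset.univ.erase j, pfL d n μ f f' ψ i y) :
    (1 / (n : ℝ) ^ k) * ∑ js : Fin k → Fin n,
        ((1 / (n : ℝ)) * ∑ i, f i
            (pfW d n μ f' (pfIter d n z φ0 (extSeq (Nat.lt_of_lt_of_le Nat.zero_lt_one hn.le) js) k))
          - (1 / (n : ℝ)) * ∑ i, f i wstar)
      ≤ (1 - μ / (μ * n + L - μ)) ^ k * ((μ * n + L - μ) / μ) *
          ((1 / (n : ℝ)) * ∑ i, f i wstar - pfB d n μ f f' φ0 (pfW d n μ f' φ0)) := by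
  have hn0 : 0 < n := by omega
  have hnR : (0 : ℝ) < n := by positivity
  have hn1 : (1 : ℝ) ≤ n := by exact_mod_cast hn.le
  have hD : 0 < μ * n + L - μ := by nlinarith
  set c : ℝ := μ / (μ * n + L - μ) with hc
  have hcpos : 0 < c := by positivity
  have hc1 : 0 ≤ 1 - c := by
    rw [hc, sub_nonneg, div_le_one hD]; nlinarith
  set fs : ℝ := (1 / (n : ℝ)) * ∑ i, f i wstar with hfs
  let V : (Fin n → EuclideanSpace ℝ (Fin d)) → ℝ :=
    fun ψ => fs - pfB d n μ f f' ψ (pfW d n μ f' ψ)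
  let U : (Fin n → EuclideanSpace ℝ (Fin d)) → ℝ :=
    fun ψ => (1 / (n : ℝ)) * ∑ i, f i (pfW d n μ f' ψ) - fs
  have hV0 : ∀ ψ, 0 ≤ V ψ := fun ψ =>
    sub_nonneg.2 (pfB_le d n μ hμ hn0 f f' hsc ψ wstar)
  have hU0 : ∀ ψ, 0 ≤ U ψ := fun ψ => sub_nonneg.2 (hstar _)
  have hstep : ∀ ψ, ∑ j, V (Function.update ψ j (z ψ j)) ≤ n * (V ψ - c * (U ψ + V ψ)) := by
    intro ψ
    have h1 : ∀ j, V (Function.update ψ j (z ψ j)) ≤ V ψ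
        - c * (f j (pfW d n μ f' ψ) - pfL d n μ f f' ψ j (pfW d n μ f' ψ)) := by
      intro j
      have := pf_step d n hn0 μ L hμ hμL f f' hgrad hsmooth hsc ψ j (z ψ j) (hz ψ j)
      simp only [V]
      linarith
    refine (Finset.sum_le_sum fun j _ => h1 j).trans (le_of_eq ?_)
    have h2 : ∀ v : ℝ, ∑ j, (v
        - c * (f j (pfW d n μ f' ψ) - pfL d n μ f f' ψ j (pfW d n μ f' ψ)))
        = n * v - c * (∑ j, f j (pfW d n μ f' ψ)
          - ∑ j, pfL d n μ f f' ψ j (pfW d n μ f' ψ)) := by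
      intro v
      rw [Finset.sum_sub_distrib, ← Finset.mul_sum, Finset.sum_sub_distrib, Finset.sum_const,
        Finset.card_univ, Fintype.card_fin, nsmul_eq_mul]
    rw [h2]
    simp only [V, U, pfB]
    field_simp
    ring
  have hUV : ∀ ψ, U ψ ≤ (1 / c) * V ψ := by
    intro ψ
    have h1 : 0 ≤ (n : ℝ) * (V ψ - c * (U ψ + V ψ)) :=
      (Finset.sum_nonneg fun j _ => hV0 _).trans (hstep ψ)
    have h2 := nonneg_of_mul_nonneg_right h1 hnR
    have h3 := mul_nonneg hcpos.le (hV0 ψ)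
    rw [one_div, ← div_eq_inv_mul, le_div_iff₀ hcpos]
    linarith
  have hind : ∀ k : ℕ, ∑ js : Fin k → Fin n, V (pfIter d n z φ0 (extSeq hn0 js) k)
      ≤ (n : ℝ) ^ k * ((1 - c) ^ k * V φ0) := by
    intro k
    induction k with
    | zero => simp [pfIter]
    | succ k ih =>
      rw [pf_sum_snoc]
      simp only [pfIter_snoc]
      calc _ ≤ ∑ js : Fin k → Fin n, n * (1 - c) * V (pfIter d n z φ0 (extSeq hn0 js) k) := by
            refine Finset.sum_le_sum fun js _ => (hstep _).trans ?_
            have := mul_nonneg hnR.le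
              (mul_nonneg hcpos.le (hU0 (pfIter d n z φ0 (extSeq hn0 js) k)))
            linarith
        _ = n * (1 - c) * ∑ js : Fin k → Fin n, V (pfIter d n z φ0 (extSeq hn0 js) k) := by
            rw [Finset.mul_sum]
        _ ≤ n * (1 - c) * ((n : ℝ) ^ k * ((1 - c) ^ k * V φ0)) := by gcongr
        _ = _ := by ring
  have hci : (μ * n + L - μ) / μ = 1 / c := by rw [hc, one_div_div]
  rw [hci]
  change (1 / (n : ℝ) ^ k) * ∑ js : Fin k → Fin n, U (pfIter d n z φ0 (extSeq hn0 js) k)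
    ≤ (1 - c) ^ k * (1 / c) * V φ0
  calc _ ≤ (1 / (n : ℝ) ^ k) * ∑ js : Fin k → Fin n,
            (1 / c) * V (pfIter d n z φ0 (extSeq hn0 js) k) := by
        gcongr with js
        exact hUV _
    _ = (1 / (n : ℝ) ^ k) * ((1 / c) *
          ∑ js : Fin k → Fin n, V (pfIter d n z φ0 (extSeq hn0 js) k)) := by
        rw [← Finset.mul_sum]
    _ ≤ (1 / (n : ℝ) ^ k) * ((1 / c) * ((n : ℝ) ^ k * ((1 - c) ^ k * V φ0))) := by
        gcongr
        exact hind k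
    _ = _ := by field_simp
end

section
/- Under the SAGA setup with each f_i additionally μ-strongly convex (0 < μ ≤ L), define the Lyapunov value T = (1/n)∑_i f_i(φ_i) − f(x*) − (1/n)∑_i ⟨∇f_i(x*), φ_i − x*⟩ + c‖x − x*‖² with c = 1/(2γ(1 − γμ)n), and for each index j let T^(j) be the Lyapunov value after one SAGA update with index j (iterate x^(j) and table with φ_j replaced by x). If γ = 1/(2(μn + L)) then (1/n)∑_{j=1}^n T^(j) ≤ (1 − γμ) T; if γ = 1/(3L) then (1/n)∑_{j=1}^n T^(j) ≤ (1 − min{1/(4n), μ/(3L)}) T. -/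
open scoped RealInnerProductSpace

/-- The SAGA pre-proximal point `w^(j)` for iterate `x`, table `φ` and index `j`. -/
noncomputable def sagaW (d n : ℕ) (γ : ℝ)
    (f' : Fin n → EuclideanSpace ℝ (Fin d) → EuclideanSpace ℝ (Fin d))
    (x : EuclideanSpace ℝ (Fin d)) (φ : Fin n → EuclideanSpace ℝ (Fin d))
    (j : Fin n) : EuclideanSpace ℝ (Fin d) :=
  x - γ • (f' j x - f' j (φ j) + (1 / (n : ℝ)) • ∑ i, f' i (φ i))

/-- The SAGA Lyapunov value for iterate `x` and table `φ`,
with `c = 1/(2γ(1-γμ)n)`. -/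
noncomputable def sagaT (d n : ℕ) (μ γ : ℝ)
    (f : Fin n → EuclideanSpace ℝ (Fin d) → ℝ)
    (f' : Fin n → EuclideanSpace ℝ (Fin d) → EuclideanSpace ℝ (Fin d))
    (xstar x : EuclideanSpace ℝ (Fin d))
    (φ : Fin n → EuclideanSpace ℝ (Fin d)) : ℝ :=
  (1 / (n : ℝ)) * ∑ i, f i (φ i) - (1 / (n : ℝ)) * ∑ i, f i xstar
    - (1 / (n : ℝ)) * ∑ i, ⟪f' i xstar, φ i - xstar⟫
    + (1 / (2 * γ * (1 - γ * μ) * n)) * ‖x - xstar‖ ^ 2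

section SagaHelpers

variable {E : Type*} [NormedAddCommGroup E] [InnerProductSpace ℝ E]

/-- Derivative of a function with a gradient along a line. -/
lemma saga_line [CompleteSpace E] {g : E → ℝ} {G p u : E} {t : ℝ} (hg : HasGradientAt g G (p + t • u)) :
    HasDerivAt (fun s : ℝ => g (p + s • u)) ⟪G, u⟫ t := by
  have h1 : HasDerivAt (fun s : ℝ => p + s • u) u t := by
    simpa using ((hasDerivAt_id t).smul_const u).const_add p
  have h2 := hg.hasFDerivAt.comp_hasDerivAt t h1
  simpa [Function.comp_def] using h2

/-- Descent lemma. -/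
lemma saga_descent [CompleteSpace E] {g : E → ℝ} {g' : E → E} {L : ℝ}
    (hg : ∀ x, HasGradientAt g (g' x) x) (hs : ∀ x y, ‖g' x - g' y‖ ≤ L * ‖x - y‖) (y u : E) :
    g (y + u) ≤ g y + ⟪g' y, u⟫ + L / 2 * ‖u‖ ^ 2 := by
  let ψ : ℝ → ℝ := fun t => g (y + t • u) - t * ⟪g' y, u⟫ - t ^ 2 * (L / 2 * ‖u‖ ^ 2)
  have hd : ∀ t, HasDerivAt ψ (⟪g' (y + t • u), u⟫ - ⟪g' y, u⟫ - (2 * t) * (L / 2 * ‖u‖ ^ 2)) t := by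
    intro t
    have h1 := saga_line (hg (y + t • u))
    have h2 : HasDerivAt (fun t : ℝ => t * ⟪g' y, u⟫) ⟪g' y, u⟫ t := by
      simpa using (hasDerivAt_id t).mul_const ⟪g' y, u⟫
    have h3 : HasDerivAt (fun t : ℝ => t ^ 2 * (L / 2 * ‖u‖ ^ 2)) ((2 * t) * (L / 2 * ‖u‖ ^ 2)) t := by
      simpa using (hasDerivAt_pow 2 t).mul_const (L / 2 * ‖u‖ ^ 2)
    exact (h1.sub h2).sub h3
  have hanti : AntitoneOn ψ (Set.Icc 0 1) := by
    apply antitoneOn_of_deriv_nonpos (convex_Icc 0 1)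
    · exact fun t _ => (hd t).continuousAt.continuousWithinAt
    · exact fun t _ => (hd t).differentiableAt.differentiableWithinAt
    · intro t ht
      rw [interior_Icc] at ht
      rw [(hd t).deriv, ← inner_sub_left]
      have h1 := real_inner_le_norm (g' (y + t • u) - g' y) u
      have h2 := hs (y + t • u) y
      rw [add_sub_cancel_left, norm_smul, Real.norm_of_nonneg ht.1.le] at h2
      have h3 := mul_le_mul_of_nonneg_right h2 (norm_nonneg u)
      nlinarith
  have := hanti (Set.left_mem_Icc.2 zero_le_one) (Set.right_mem_Icc.2 zero_le_one) zero_le_one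
  simp only [ψ, one_smul, zero_smul, add_zero] at this
  linarith

/-- Interpolation inequality for smooth strongly convex functions. -/
lemma saga_interp [CompleteSpace E] {g : E → ℝ} {g' : E → E} {L m : ℝ} (hm : 0 < m) (hmL : m ≤ L)
    (hg : ∀ x, HasGradientAt g (g' x) x) (hs : ∀ x y, ‖g' x - g' y‖ ≤ L * ‖x - y‖)
    (hsc : ∀ x y, g x ≥ g y + ⟪g' y, x - y⟫ + m / 2 * ‖x - y‖ ^ 2) (x y : E) :
    1 / 2 * ‖g' y - g' x‖ ^ 2 + m * L / 2 * ‖y - x‖ ^ 2 - m * ⟪g' y - g' x, y - x⟫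
      ≤ (L - m) * (g y - g x - ⟪g' x, y - x⟫) := by
  have hexp : ‖(g' y - g' x) - m • (y - x)‖ ^ 2 = ‖g' y - g' x‖ ^ 2
      - 2 * (m * ⟪g' y - g' x, y - x⟫) + m ^ 2 * ‖y - x‖ ^ 2 := by
    rw [norm_sub_sq_real, real_inner_smul_right, norm_smul, mul_pow, Real.norm_eq_abs, sq_abs]
  rcases hmL.eq_or_lt with rfl | hlt
  · have h1 := hsc x y
    have h2 := hsc y x
    have h3 := hs y x
    have h4 : ‖g' y - g' x‖ ^ 2 ≤ (m * ‖y - x‖) ^ 2 := by gcongr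
    have h5 : ⟪g' y, x - y⟫ = - ⟪g' y, y - x⟫ := by rw [← inner_neg_right, neg_sub]
    have h6 : m * ‖y - x‖ ^ 2 ≤ ⟪g' y - g' x, y - x⟫ := by
      rw [inner_sub_left]; rw [norm_sub_rev x y] at h1; linarith
    nlinarith
  · have key : ∀ s : E, ⟪(g' y - g' x) - m • (y - x), s⟫ + m / 2 * ‖y - x‖ ^ 2
        - (L - m) / 2 * ‖s‖ ^ 2 ≤ g y - g x - ⟪g' x, y - x⟫ := by
      intro s
      have h1 := saga_descent hg hs y (-s)
      have h2 := hsc (y + -s) x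
      have e : y + -s - x = (y - x) - s := by abel
      rw [e, norm_sub_sq_real, inner_sub_right] at h2
      rw [norm_neg, inner_neg_right] at h1
      rw [inner_sub_left, inner_sub_left, real_inner_smul_left]
      nlinarith
    have hpos : 0 < L - m := by linarith
    have h := key ((L - m)⁻¹ • ((g' y - g' x) - m • (y - x)))
    rw [real_inner_smul_right, real_inner_self_eq_norm_sq, norm_smul, mul_pow, Real.norm_eq_abs,
      sq_abs] at h
    have h' := mul_le_mul_of_nonneg_left h hpos.le
    have e : (L - m) * ((L - m)⁻¹ * ‖(g' y - g' x) - m • (y - x)‖ ^ 2 + m / 2 * ‖y - x‖ ^ 2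
        - (L - m) / 2 * ((L - m)⁻¹ ^ 2 * ‖(g' y - g' x) - m • (y - x)‖ ^ 2))
        = 1 / 2 * ‖(g' y - g' x) - m • (y - x)‖ ^ 2 + (L - m) * (m / 2 * ‖y - x‖ ^ 2) := by
      field_simp; ring
    rw [e, hexp] at h'
    nlinarith

/-- Cocoercivity type bound. -/
lemma saga_coco [CompleteSpace E] {g : E → ℝ} {g' : E → E} {L m : ℝ} (hm : 0 < m) (hmL : m ≤ L)
    (hg : ∀ x, HasGradientAt g (g' x) x) (hs : ∀ x y, ‖g' x - g' y‖ ≤ L * ‖x - y‖)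
    (hsc : ∀ x y, g x ≥ g y + ⟪g' y, x - y⟫ + m / 2 * ‖x - y‖ ^ 2) (x y : E) :
    ‖g' y - g' x‖ ^ 2 ≤ 2 * L * (g y - g x - ⟪g' x, y - x⟫) := by
  have hL : 0 < L := by linarith
  have h1 := saga_descent hg hs y (-(L⁻¹ • (g' y - g' x)))
  have h2 := hsc (y + -(L⁻¹ • (g' y - g' x))) x
  have e : y + -(L⁻¹ • (g' y - g' x)) - x = (y - x) - L⁻¹ • (g' y - g' x) := by abel
  have h0 : 0 ≤ m / 2 * ‖y + -(L⁻¹ • (g' y - g' x)) - x‖ ^ 2 := by positivity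
  rw [e, inner_sub_right, ← e] at h2
  rw [norm_neg, inner_neg_right, norm_smul, mul_pow, Real.norm_eq_abs, sq_abs] at h1
  have e3 : ⟪g' y, L⁻¹ • (g' y - g' x)⟫ - ⟪g' x, L⁻¹ • (g' y - g' x)⟫
      = L⁻¹ * ‖g' y - g' x‖ ^ 2 := by
    rw [← inner_sub_left, real_inner_smul_right, real_inner_self_eq_norm_sq]
  have h4 : L⁻¹ * ‖g' y - g' x‖ ^ 2 - L / 2 * (L⁻¹ ^ 2 * ‖g' y - g' x‖ ^ 2)
      ≤ g y - g x - ⟪g' x, y - x⟫ := by linarith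
  have h5 := mul_le_mul_of_nonneg_left h4 (by linarith : 0 ≤ 2 * L)
  have e6 : 2 * L * (L⁻¹ * ‖g' y - g' x‖ ^ 2 - L / 2 * (L⁻¹ ^ 2 * ‖g' y - g' x‖ ^ 2))
      = ‖g' y - g' x‖ ^ 2 := by field_simp; ring
  linarith

/-- First-order optimality condition for a smooth plus convex objective. -/
lemma saga_opt [CompleteSpace E] {g h : E → ℝ} {G p : E} (hg : HasGradientAt g G p)
    (hh : ConvexOn ℝ Set.univ h) (hmin : ∀ y, g p + h p ≤ g y + h y) (y : E) :
    0 ≤ ⟪G, y - p⟫ + (h y - h p) := by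
  have h1 : HasDerivAt (fun s : ℝ => g (p + s • (y - p))) ⟪G, y - p⟫ 0 :=
    saga_line (by simpa using hg)
  have h2 := h1.tendsto_slope_zero_right
  have h3 : -(h y - h p) ≤ ⟪G, y - p⟫ := by
    refine ge_of_tendsto h2 ?_
    filter_upwards [Ioc_mem_nhdsGT (zero_lt_one : (0:ℝ) < 1)] with t ht
    have a := hmin (p + t • (y - p))
    have b := hh.2 (Set.mem_univ p) (Set.mem_univ y) (by linarith [ht.2] : 0 ≤ 1 - t) ht.1.le
      (by ring)
    have e : (1 - t) • p + t • y = p + t • (y - p) := by module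
    rw [e] at b
    simp only [smul_eq_mul] at b
    simp only [zero_add, zero_smul, add_zero, smul_eq_mul]
    have c : t * -(h y - h p) ≤ g (p + t • (y - p)) - g p := by linarith
    have := mul_le_mul_of_nonneg_left c (inv_pos.2 ht.1).le
    rwa [inv_mul_cancel_left₀ ht.1.ne'] at this
  linarith

lemma saga_quad_grad [CompleteSpace E] (γ : ℝ) (hγ : 0 < γ) (w p : E) :
    HasGradientAt (fun y => 1 / (2 * γ) * ‖y - w‖ ^ 2) (γ⁻¹ • (p - w)) p := by
  rw [hasGradientAt_iff_hasFDerivAt]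
  have h := (((hasFDerivAt_id p).sub_const w).norm_sq).const_mul (1 / (2 * γ))
  refine h.congr_fderiv ?_
  ext v
  simp [inner_smul_left]
  field_simp

/-- The prox step is nonexpansive towards a fixed point. -/
lemma saga_prox [CompleteSpace E] {F h : E → ℝ} {G xs w p : E} {γ : ℝ} (hγ : 0 < γ)
    (hF : HasGradientAt F G xs) (hh : ConvexOn ℝ Set.univ h)
    (hmin : ∀ y, F xs + h xs ≤ F y + h y)
    (hP : ∀ y, h p + 1 / (2 * γ) * ‖p - w‖ ^ 2 ≤ h y + 1 / (2 * γ) * ‖y - w‖ ^ 2) :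
    ‖p - xs‖ ^ 2 ≤ ‖w + γ • G - xs‖ ^ 2 := by
  have h1 := saga_opt hF hh hmin p
  have h2 := saga_opt (saga_quad_grad γ hγ w p) hh (fun y => by linarith [hP y]) xs
  have h3 : 0 ≤ ⟪G, p - xs⟫ + ⟪γ⁻¹ • (p - w), xs - p⟫ := by linarith
  rw [real_inner_smul_left] at h3
  have h4 := mul_nonneg hγ.le h3
  rw [mul_add, mul_inv_cancel_left₀ hγ.ne'] at h4
  have h5 : ⟪w + γ • G - xs, p - xs⟫ - ‖p - xs‖ ^ 2 = γ * ⟪G, p - xs⟫ + ⟪p - w, xs - p⟫ := by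
    rw [← real_inner_self_eq_norm_sq, ← inner_sub_left, ← real_inner_smul_left,
      ← neg_sub p xs, inner_neg_right, ← sub_eq_add_neg, ← inner_sub_left]
    congr 1
    abel
  have h6 := norm_sub_sq_real (w + γ • G - xs) (p - xs)
  nlinarith [sq_nonneg ‖w + γ • G - xs - (p - xs)‖]

/-- Variance bound, stated for unnormalised sums. -/
lemma saga_var {n : ℕ} (hn : 1 ≤ n) (a b : Fin n → E) (β : ℝ) (hβ : 0 < β) :
    ∑ j, ‖b j - a j + (1 / (n : ℝ)) • ∑ i, a i‖ ^ 2 ≤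
      (1 + 1 / β) * ∑ j, ‖a j‖ ^ 2 + (1 + β) * ∑ j, ‖b j‖ ^ 2
        - β * (n * ‖(1 / (n : ℝ)) • ∑ i, b i‖ ^ 2) := by
  have hn0 : (n : ℝ) ≠ 0 := by positivity
  set A := (1 / (n : ℝ)) • ∑ i, a i with hA
  set B := (1 / (n : ℝ)) • ∑ i, b i with hB
  have sA : ∑ i, a i = (n : ℝ) • A := by rw [hA, smul_smul]; field_simp; simp
  have sB : ∑ i, b i = (n : ℝ) • B := by rw [hB, smul_smul]; field_simp; simp
  -- pointwise Young inequality
  have hy : ∀ j, ‖b j - a j + A‖ ^ 2 ≤ ‖B‖ ^ 2 + 2 * ⟪B, (b j - B) - (a j - A)⟫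
      + ((1 + β) * ‖b j - B‖ ^ 2 + (1 + 1 / β) * ‖a j - A‖ ^ 2) := by
    intro j
    have e : b j - a j + A = B + ((b j - B) - (a j - A)) := by abel
    rw [e, norm_add_sq_real]
    have h1 := norm_sub_sq_real (b j - B) (a j - A)
    have h2 := sq_nonneg ‖β • (b j - B) + (a j - A)‖
    rw [norm_add_sq_real, norm_smul, mul_pow, Real.norm_eq_abs, sq_abs, real_inner_smul_left] at h2
    have h3 := mul_le_mul_of_nonneg_left h2 (inv_pos.2 hβ).le
    have e2 : β⁻¹ * (β ^ 2 * ‖b j - B‖ ^ 2 + 2 * (β * ⟪b j - B, a j - A⟫) + ‖a j - A‖ ^ 2)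
      = β * ‖b j - B‖ ^ 2 + 2 * ⟪b j - B, a j - A⟫ + 1 / β * ‖a j - A‖ ^ 2 := by
      field_simp
    rw [e2] at h3
    linarith
  have vB : ∑ j, ‖b j - B‖ ^ 2 = ∑ j, ‖b j‖ ^ 2 - n * ‖B‖ ^ 2 := by
    simp only [norm_sub_sq_real, Finset.sum_add_distrib, Finset.sum_sub_distrib, ← Finset.mul_sum,
      ← sum_inner, sB, real_inner_smul_left, real_inner_self_eq_norm_sq]
    simp; ring
  have vA : ∑ j, ‖a j - A‖ ^ 2 = ∑ j, ‖a j‖ ^ 2 - n * ‖A‖ ^ 2 := by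
    simp only [norm_sub_sq_real, Finset.sum_add_distrib, Finset.sum_sub_distrib, ← Finset.mul_sum,
      ← sum_inner, sA, real_inner_smul_left, real_inner_self_eq_norm_sq]
    simp; ring
  have z : ∑ j, ((b j - B) - (a j - A)) = 0 := by
    simp only [Finset.sum_sub_distrib, sA, sB]
    simp [← Nat.cast_smul_eq_nsmul ℝ]
  have hsum := Finset.sum_le_sum (fun j (_ : j ∈ Finset.univ) => hy j)
  rw [Finset.sum_add_distrib, Finset.sum_add_distrib, Finset.sum_add_distrib, ← Finset.mul_sum,
    ← Finset.mul_sum, ← Finset.mul_sum, ← inner_sum, z, vA, vB] at hsum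
  simp only [inner_zero_right, Finset.sum_const, Finset.card_univ, Fintype.card_fin,
    nsmul_eq_mul] at hsum
  have : 0 ≤ (1 + 1 / β) * (n * ‖A‖ ^ 2) := by positivity
  nlinarith

/-- The combined one step bound: numeric inequality given the averaged quantities. -/
lemma saga_step [CompleteSpace E] {n : ℕ} (hn : 1 ≤ n) {μ L γ : ℝ}
    (hμ : 0 < μ) (hμL : μ ≤ L) (hγ : 0 < γ)
    (f : Fin n → E → ℝ) (f' : Fin n → E → E)
    (hgrad : ∀ i x, HasGradientAt (f i) (f' i x) x)
    (hsmooth : ∀ i x y, ‖f' i x - f' i y‖ ≤ L * ‖x - y‖)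
    (hsc : ∀ i x y, f i x ≥ f i y + ⟪f' i y, x - y⟫ + μ / 2 * ‖x - y‖ ^ 2)
    (h : E → ℝ) (hh : ConvexOn ℝ Set.univ h) (xs : E)
    (hstar : ∀ y, (1 / (n : ℝ)) * ∑ i, f i xs + h xs ≤ (1 / (n : ℝ)) * ∑ i, f i y + h y)
    (x : E) (φ : Fin n → E) (xP : Fin n → E)
    (hP : ∀ j y, h (xP j) + 1 / (2 * γ) *
          ‖xP j - (x - γ • (f' j x - f' j (φ j) + (1 / (n : ℝ)) • ∑ i, f' i (φ i)))‖ ^ 2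
        ≤ h y + 1 / (2 * γ) *
          ‖y - (x - γ • (f' j x - f' j (φ j) + (1 / (n : ℝ)) • ∑ i, f' i (φ i)))‖ ^ 2)
    (β : ℝ) (hβ : 0 < β) (hβγ : (1 + β) * γ = 1 / L) :
    0 ≤ (1 / (n : ℝ)) * ∑ i, (f i x - f i xs - ⟪f' i xs, x - xs⟫) ∧
    0 ≤ (1 / (n : ℝ)) * ∑ i, (f i (φ i) - f i xs - ⟪f' i xs, φ i - xs⟫) ∧
    (1 / (n : ℝ)) * ∑ j, ‖xP j - xs‖ ^ 2 ≤ (1 - γ * μ) * ‖x - xs‖ ^ 2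
      - 2 * γ * (1 - γ * μ) * ((1 / (n : ℝ)) * ∑ i, (f i x - f i xs - ⟪f' i xs, x - xs⟫))
      + γ ^ 2 * (1 + 1 / β) * (2 * L) *
        ((1 / (n : ℝ)) * ∑ i, (f i (φ i) - f i xs - ⟪f' i xs, φ i - xs⟫)) := by
  have hL : 0 < L := by linarith
  have hnpos : (0 : ℝ) < n := by positivity
  have hn0 : (n : ℝ) ≠ 0 := hnpos.ne'
  have hq : ∀ i z, 0 ≤ f i z - f i xs - ⟪f' i xs, z - xs⟫ := by
    intro i z
    have := hsc i z xs
    have : 0 ≤ μ / 2 * ‖z - xs‖ ^ 2 := by positivity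
    linarith
  refine ⟨mul_nonneg (by positivity) (Finset.sum_nonneg fun i _ => hq i x),
    mul_nonneg (by positivity) (Finset.sum_nonneg fun i _ => hq i (φ i)), ?_⟩
  set a : Fin n → E := fun j => f' j (φ j) - f' j xs with ha
  set b : Fin n → E := fun j => f' j x - f' j xs with hb
  set B := (1 / (n : ℝ)) • ∑ i, b i with hB
  have sB : ∑ i, b i = (n : ℝ) • B := by rw [hB, smul_smul]; field_simp; simp
  have hF : HasGradientAt (fun y => (1 / (n : ℝ)) * ∑ i, f i y)
      ((1 / (n : ℝ)) • ∑ i, f' i xs) xs := by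
    rw [hasGradientAt_iff_hasFDerivAt]
    have := (HasFDerivAt.fun_sum (u := Finset.univ)
      (fun i _ => (hgrad i xs).hasFDerivAt)).const_mul (1 / (n : ℝ))
    refine this.congr_fderiv ?_
    simp [map_sum, map_smul]
  -- prox bound and expansion
  have hp : ∀ j, ‖xP j - xs‖ ^ 2 ≤ ‖x - xs‖ ^ 2
      - 2 * γ * ⟪x - xs, b j - a j + (1 / (n : ℝ)) • ∑ i, a i⟫
      + γ ^ 2 * ‖b j - a j + (1 / (n : ℝ)) • ∑ i, a i‖ ^ 2 := by
    intro j
    refine (saga_prox hγ hF hh hstar (hP j)).trans (le_of_eq ?_)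
    have e : x - γ • (f' j x - f' j (φ j) + (1 / (n : ℝ)) • ∑ i, f' i (φ i))
        + γ • (1 / (n : ℝ)) • ∑ i, f' i xs - xs
        = (x - xs) - γ • (b j - a j + (1 / (n : ℝ)) • ∑ i, a i) := by
      simp only [ha, hb, Finset.sum_sub_distrib]
      module
    rw [e, norm_sub_sq_real, real_inner_smul_right, norm_smul, mul_pow, Real.norm_eq_abs, sq_abs]
    ring
  have hsum := Finset.sum_le_sum (fun j (_ : j ∈ Finset.univ) => hp j)
  have hmean : ∑ j, (b j - a j + (1 / (n : ℝ)) • ∑ i, a i) = (n : ℝ) • B := by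
    rw [Finset.sum_add_distrib, Finset.sum_sub_distrib, sB]
    simp only [Finset.sum_const, Finset.card_univ, Fintype.card_fin, ← Nat.cast_smul_eq_nsmul ℝ,
      smul_smul]
    rw [mul_one_div_cancel hn0, one_smul]; abel
  rw [Finset.sum_add_distrib, Finset.sum_sub_distrib, ← Finset.mul_sum, ← Finset.mul_sum,
    ← inner_sum, hmean, real_inner_smul_right] at hsum
  simp only [Finset.sum_const, Finset.card_univ, Fintype.card_fin, nsmul_eq_mul] at hsum
  have hvar := saga_var hn a b β hβ
  rw [← hB] at hvar
  -- bounds on gradients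
  have hA2 : ∑ j, ‖a j‖ ^ 2 ≤ 2 * L * ∑ i, (f i (φ i) - f i xs - ⟪f' i xs, φ i - xs⟫) := by
    rw [Finset.mul_sum]
    exact Finset.sum_le_sum fun i _ =>
      saga_coco hμ hμL (hgrad i) (hsmooth i) (hsc i) xs (φ i)
  set Q := ∑ i, (f i x - f i xs - ⟪f' i xs, x - xs⟫) with hQ
  set P := ∑ i, (f i (φ i) - f i xs - ⟪f' i xs, φ i - xs⟫) with hPdef
  have hI : (n : ℝ) * ⟪x - xs, B⟫ = ∑ i, ⟪b i, x - xs⟫ := by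
    rw [← real_inner_smul_right, ← sB, ← sum_inner, real_inner_comm]
  have hlem1 : (L - μ) * Q + μ * L / 2 * (n * ‖x - xs‖ ^ 2) + 1 / 2 * ∑ j, ‖b j‖ ^ 2
      ≤ L * (n * ⟪x - xs, B⟫) := by
    have : ∀ i, (L - μ) * (f i x - f i xs - ⟪f' i xs, x - xs⟫) + μ * L / 2 * ‖x - xs‖ ^ 2
        + 1 / 2 * ‖b i‖ ^ 2 ≤ L * ⟪b i, x - xs⟫ := by
      intro i
      have h1 := saga_interp hμ hμL (hgrad i) (hsmooth i) (hsc i) x xs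
      have e1 : ⟪f' i xs - f' i x, xs - x⟫ = ⟪b i, x - xs⟫ := by
        simp only [hb]
        rw [← neg_sub (f' i x), ← neg_sub x, inner_neg_neg]
      have e2 : ⟪f' i x, xs - x⟫ = - ⟪b i, x - xs⟫ - ⟪f' i xs, x - xs⟫ := by
        simp only [hb]
        rw [← neg_sub x, inner_neg_right, inner_sub_left]; ring
      rw [e1, e2, norm_sub_rev xs x, norm_sub_rev (f' i xs)] at h1
      simp only [hb] at h1 ⊢
      nlinarith
    have := Finset.sum_le_sum (fun j (_ : j ∈ Finset.univ) => this j)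
    rw [Finset.sum_add_distrib, Finset.sum_add_distrib, ← Finset.mul_sum, ← Finset.mul_sum,
      ← Finset.mul_sum, ← Finset.mul_sum, ← hQ, ← hI] at this
    simp only [Finset.sum_const, Finset.card_univ, Fintype.card_fin, nsmul_eq_mul] at this
    linarith
  have hstr : 2 * μ * Q ≤ n * ‖B‖ ^ 2 := by
    have h1 : Q ≤ n * ⟪x - xs, B⟫ - μ / 2 * (n * ‖x - xs‖ ^ 2) := by
      have : ∀ i, f i x - f i xs - ⟪f' i xs, x - xs⟫ ≤ ⟪b i, x - xs⟫ - μ / 2 * ‖x - xs‖ ^ 2 := by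
        intro i
        have h1 := hsc i xs x
        rw [← neg_sub x, inner_neg_right, norm_neg] at h1
        simp only [hb, inner_sub_left]
        linarith
      have := Finset.sum_le_sum (fun j (_ : j ∈ Finset.univ) => this j)
      rw [← hQ, Finset.sum_sub_distrib, ← hI] at this
      simp only [Finset.sum_const, Finset.card_univ, Fintype.card_fin, nsmul_eq_mul] at this
      linarith
    have h2 := sq_nonneg ‖B - μ • (x - xs)‖
    rw [norm_sub_sq_real, real_inner_smul_right, norm_smul μ, mul_pow, Real.norm_eq_abs, sq_abs,
      real_inner_comm] at h2
    have h3 := mul_le_mul_of_nonneg_left h2 hnpos.le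
    nlinarith
  -- combine
  have hfin : ∑ j, ‖xP j - xs‖ ^ 2 ≤ (1 - γ * μ) * (n * ‖x - xs‖ ^ 2)
      - 2 * γ * (1 - γ * μ) * Q + γ ^ 2 * (1 + 1 / β) * (2 * L) * P := by
    have k1 := mul_le_mul_of_nonneg_left hvar (sq_nonneg γ)
    have k2 := mul_le_mul_of_nonneg_left hA2 (by positivity : 0 ≤ γ ^ 2 * (1 + 1 / β))
    have k3 := mul_le_mul_of_nonneg_left hlem1 (by positivity : 0 ≤ 2 * γ / L)
    have k4 := mul_le_mul_of_nonneg_left hstr (by positivity : 0 ≤ γ ^ 2 * β)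
    have e1 : γ ^ 2 * (1 + β) = γ / L := by
      rw [pow_two, mul_assoc, mul_comm γ (1 + β), hβγ]; ring
    have e2 : γ ^ 2 * β = γ / L - γ ^ 2 := by linarith
    have e3 : 2 * γ / L * ((L - μ) * Q + μ * L / 2 * (n * ‖x - xs‖ ^ 2) + 1 / 2 * ∑ j, ‖b j‖ ^ 2)
      = 2 * γ * Q - 2 * μ * (γ / L) * Q + γ * μ * (n * ‖x - xs‖ ^ 2)
        + γ / L * ∑ j, ‖b j‖ ^ 2 := by field_simp
    have e4 : 2 * γ / L * (L * (n * ⟪x - xs, B⟫)) = 2 * γ * (n * ⟪x - xs, B⟫) := by field_simp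
    have e5 : γ ^ 2 * ((1 + 1 / β) * ∑ j, ‖a j‖ ^ 2 + (1 + β) * ∑ j, ‖b j‖ ^ 2
        - β * (n * ‖B‖ ^ 2)) = γ ^ 2 * (1 + 1 / β) * ∑ j, ‖a j‖ ^ 2 + γ / L * ∑ j, ‖b j‖ ^ 2
        - γ ^ 2 * β * (n * ‖B‖ ^ 2) := by rw [← e1]; ring
    have e6 : γ ^ 2 * β * (2 * μ * Q) = 2 * μ * (γ / L) * Q - 2 * γ ^ 2 * μ * Q := by
      rw [e2]; ring
    rw [e3, e4] at k3
    rw [e5] at k1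
    rw [e6] at k4
    linarith
  have := mul_le_mul_of_nonneg_left hfin (by positivity : 0 ≤ 1 / (n : ℝ))
  refine this.trans (le_of_eq ?_)
  field_simp

end SagaHelpers

/-- Final arithmetic. -/
lemma saga_arith {N μ L γ β ρ Dx Dφ R R' : ℝ} (hN : 0 < N) (hγ : 0 < γ)
    (hγμ : 0 < 1 - γ * μ) (hφ : 0 ≤ Dφ) (hR : 0 ≤ R) (hρ : ρ ≤ γ * μ)
    (hD : ρ - 1 / N + γ * (1 + 1 / β) * L / ((1 - γ * μ) * N) ≤ 0)
    (hstep : R' ≤ (1 - γ * μ) * R - 2 * γ * (1 - γ * μ) * Dx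
      + γ ^ 2 * (1 + 1 / β) * (2 * L) * Dφ) :
    (1 / N) * Dx + (1 - 1 / N) * Dφ + 1 / (2 * γ * (1 - γ * μ) * N) * R'
      ≤ (1 - ρ) * (Dφ + 1 / (2 * γ * (1 - γ * μ) * N) * R) := by
  have hc : 0 < 1 / (2 * γ * (1 - γ * μ) * N) := by positivity
  have h1 := mul_le_mul_of_nonneg_left hstep hc.le
  have e : 1 / (2 * γ * (1 - γ * μ) * N) * ((1 - γ * μ) * R - 2 * γ * (1 - γ * μ) * Dx
      + γ ^ 2 * (1 + 1 / β) * (2 * L) * Dφ) = 1 / (2 * γ * (1 - γ * μ) * N) * (1 - γ * μ) * R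
      - 1 / N * Dx + γ * (1 + 1 / β) * L / ((1 - γ * μ) * N) * Dφ := by
    have := hγμ.ne'
    generalize 1 - γ * μ = s at *
    generalize 1 + 1 / β = r at *
    field_simp
  rw [e] at h1
  have h2 := mul_nonneg (mul_nonneg hc.le hR) (sub_nonneg.2 hρ)
  have h3 := mul_le_mul_of_nonneg_right hD hφ
  nlinarith

lemma saga_sum_update {n : ℕ} {E : Type*} (q : Fin n → E → ℝ) (φ : Fin n → E) (x : E) (j : Fin n) :
    ∑ i, q i (Function.update φ j x i) = ∑ i, q i (φ i) + (q j x - q j (φ j)) := by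
  rw [← sub_eq_iff_eq_add', ← Finset.sum_sub_distrib, Finset.sum_eq_single j]
  · simp
  · intro i _ hi; simp [Function.update_of_ne hi]
  · simp

lemma saga_T_eq (d n : ℕ) (μ γ : ℝ)
    (f : Fin n → EuclideanSpace ℝ (Fin d) → ℝ)
    (f' : Fin n → EuclideanSpace ℝ (Fin d) → EuclideanSpace ℝ (Fin d))
    (xstar x : EuclideanSpace ℝ (Fin d))
    (φ : Fin n → EuclideanSpace ℝ (Fin d)) : sagaT d n μ γ f f' xstar x φ =
    (1 / (n : ℝ)) * ∑ i, (f i (φ i) - f i xstar - ⟪f' i xstar, φ i - xstar⟫)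
    + (1 / (2 * γ * (1 - γ * μ) * n)) * ‖x - xstar‖ ^ 2 := by
  rw [sagaT, Finset.sum_sub_distrib, Finset.sum_sub_distrib]; ring

lemma saga_T_avg (d n : ℕ) (hn : 1 ≤ n) (μ γ : ℝ)
    (f : Fin n → EuclideanSpace ℝ (Fin d) → ℝ)
    (f' : Fin n → EuclideanSpace ℝ (Fin d) → EuclideanSpace ℝ (Fin d))
    (xstar x : EuclideanSpace ℝ (Fin d))
    (φ xP : Fin n → EuclideanSpace ℝ (Fin d)) :
    (1 / (n : ℝ)) * ∑ j, sagaT d n μ γ f f' xstar (xP j) (Function.update φ j x) =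
    (1 / (n : ℝ)) * ((1 / (n : ℝ)) * ∑ i, (f i x - f i xstar - ⟪f' i xstar, x - xstar⟫))
    + (1 - 1 / (n : ℝ)) *
      ((1 / (n : ℝ)) * ∑ i, (f i (φ i) - f i xstar - ⟪f' i xstar, φ i - xstar⟫))
    + (1 / (2 * γ * (1 - γ * μ) * n)) * ((1 / (n : ℝ)) * ∑ j, ‖xP j - xstar‖ ^ 2) := by
  have hn0 : (n : ℝ) ≠ 0 := by positivity
  simp only [saga_T_eq]
  have hu : ∀ j, ∑ i, (f i (Function.update φ j x i) - f i xstar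
      - ⟪f' i xstar, Function.update φ j x i - xstar⟫) = _ := fun j =>
    saga_sum_update (fun i z => f i z - f i xstar - ⟪f' i xstar, z - xstar⟫) φ x j
  simp only [hu]
  rw [Finset.sum_add_distrib, ← Finset.mul_sum, ← Finset.mul_sum, Finset.sum_add_distrib,
    Finset.sum_sub_distrib (fun i => f i x - f i xstar - ⟪f' i xstar, x - xstar⟫)]
  simp only [Finset.sum_const, Finset.card_univ, Fintype.card_fin, nsmul_eq_mul]
  generalize ∑ i, (f i (φ i) - f i xstar - ⟪f' i xstar, φ i - xstar⟫) = P
  generalize ∑ i, (f i x - f i xstar - ⟪f' i xstar, x - xstar⟫) = Q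
  generalize ∑ j, ‖xP j - xstar‖ ^ 2 = R
  generalize 1 / (2 * γ * (1 - γ * μ) * n) = c
  field_simp
  ring

theorem saga_lyapunov_one_step (d n : ℕ) (hn : 1 ≤ n) (μ L γ : ℝ)
    (hμ : 0 < μ) (hμL : μ ≤ L) (hγ : 0 < γ)
    (f : Fin n → EuclideanSpace ℝ (Fin d) → ℝ)
    (f' : Fin n → EuclideanSpace ℝ (Fin d) → EuclideanSpace ℝ (Fin d))
    (hgrad : ∀ i x, HasGradientAt (f i) (f' i x) x)
    (hconv : ∀ i, ConvexOn ℝ Set.univ (f i))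
    (hsmooth : ∀ i x y, ‖f' i x - f' i y‖ ≤ L * ‖x - y‖)
    (hsc : ∀ i x y, f i x ≥ f i y + ⟪f' i y, x - y⟫ + μ / 2 * ‖x - y‖ ^ 2)
    (h : EuclideanSpace ℝ (Fin d) → ℝ) (hh : ConvexOn ℝ Set.univ h)
    (xstar : EuclideanSpace ℝ (Fin d))
    (hstar : ∀ y, (1 / (n : ℝ)) * ∑ i, f i xstar + h xstar
        ≤ (1 / (n : ℝ)) * ∑ i, f i y + h y)
    (x : EuclideanSpace ℝ (Fin d)) (φ : Fin n → EuclideanSpace ℝ (Fin d))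
    (xP : Fin n → EuclideanSpace ℝ (Fin d))
    (hP : ∀ j y, h (xP j) + 1 / (2 * γ) * ‖xP j - sagaW d n γ f' x φ j‖ ^ 2
        ≤ h y + 1 / (2 * γ) * ‖y - sagaW d n γ f' x φ j‖ ^ 2) :
    (γ = 1 / (2 * (μ * n + L)) →
      (1 / (n : ℝ)) * ∑ j, sagaT d n μ γ f f' xstar (xP j) (Function.update φ j x)
        ≤ (1 - γ * μ) * sagaT d n μ γ f f' xstar x φ) ∧
    (γ = 1 / (3 * L) →
      (1 / (n : ℝ)) * ∑ j, sagaT d n μ γ f f' xstar (xP j) (Function.update φ j x)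
        ≤ (1 - min (1 / (4 * (n : ℝ))) (μ / (3 * L))) * sagaT d n μ γ f f' xstar x φ) := by
  have hL : 0 < L := by linarith
  have hn1 : (1 : ℝ) ≤ n := by exact_mod_cast hn
  have hnpos : (0 : ℝ) < n := by linarith
  have hstep := saga_step hn hμ hμL hγ f f' hgrad hsmooth hsc h hh xstar hstar x φ xP
    (fun j y => by simpa only [sagaW] using hP j y)
  rw [saga_T_avg d n hn, saga_T_eq]
  constructor
  · intro hg
    have hma : μ ≤ μ * n := by nlinarith
    have ha : 0 < μ * n := by positivity
    obtain ⟨_, h2, h3⟩ := hstep ((2 * (μ * n) + L) / L) (by positivity) (by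
      rw [hg]; field_simp; ring)
    have hs : 1 - γ * μ = (2 * (μ * n) + 2 * L - μ) / (2 * (μ * n + L)) := by
      rw [hg]; field_simp
    have hs0 : 0 < 2 * (μ * n) + 2 * L - μ := by linarith
    refine saga_arith hnpos hγ ?_ h2 (sq_nonneg _) le_rfl ?_ h3
    · rw [hs]; positivity
    · have e : γ * (1 + 1 / ((2 * (μ * n) + L) / L)) * L = L / (2 * (μ * n) + L) := by
        rw [hg]; field_simp; ring
      rw [e, hs]
      have e2 : γ * μ - 1 / (n : ℝ) = - (((μ * n + 2 * L) / (2 * (μ * n + L))) / n) := by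
        rw [hg]; field_simp; ring
      have hX : L / (2 * (μ * n) + L) /
          ((2 * (μ * n) + 2 * L - μ) / (2 * (μ * n + L)))
          ≤ (μ * n + 2 * L) / (2 * (μ * n + L)) := by
        generalize μ * n = a at *
        rw [div_div, div_le_div_iff₀ (by positivity) (by positivity)]
        have e4 : (2 * a + L) * ((2 * a + 2 * L - μ) / (2 * (a + L)))
          = (2 * a + L) * (2 * a + 2 * L - μ) / (2 * (a + L)) := by ring
        rw [e4, mul_div_assoc', le_div_iff₀ (by positivity)]
        have k : (a + 2 * L) * ((2 * a + L) * (a + 2 * L)) ≤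
            (a + 2 * L) * ((2 * a + L) * (2 * a + 2 * L - μ)) := by
          gcongr; linarith
        have k2 : 0 < a * L * L := by positivity
        have k3 : 0 < a * a * L := by positivity
        have k4 : 0 < a * a * a := by positivity
        nlinarith
      have := div_le_div_of_nonneg_right hX hnpos.le
      rw [div_div _ _ (n : ℝ)] at this
      rw [e2]
      linarith
  · intro hg
    obtain ⟨_, h2, h3⟩ := hstep 2 (by norm_num) (by rw [hg]; field_simp; norm_num)
    have hgm : γ * μ = μ / (3 * L) := by rw [hg]; ring
    have hgm2 : γ * μ ≤ 1 / 3 := by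
      rw [hgm, div_le_div_iff₀ (by positivity) (by norm_num)]; linarith
    have hs0 : 0 < 1 - γ * μ := by linarith
    refine saga_arith hnpos hγ hs0 h2 (sq_nonneg _) (by rw [hgm]; exact min_le_right _ _) ?_ h3
    have hm := min_le_left (1 / (4 * (n : ℝ))) (μ / (3 * L))
    have e : γ * (1 + 1 / 2) * L = 1 / 2 := by rw [hg]; field_simp; norm_num
    rw [e]
    have k : 1 / 2 / ((1 - γ * μ) * n) ≤ 3 / (4 * (n : ℝ)) := by
      rw [div_le_div_iff₀ (by positivity) (by positivity)]
      nlinarith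
    have e2 : 1 / (n : ℝ) = 1 / (4 * (n : ℝ)) + 3 / (4 * (n : ℝ)) := by field_simp; norm_num
    linarith
end

section
/- Consider SVRG with step size 1/η, η = 4L, and epoch length m. Set c₁ = 1 − μ/η and c₄ = ∑_{t=0}^{m−1} c₁^t, and define the Lyapunov value T^r = ‖x̃^r − x*‖² + (c₄/(2L))[f(x̃^r) − f(x*)]. Assume that along every realization of the random inner-loop indices the anchor satisfies f(x̃^{r+1}) − f(x*) ≤ (1/c₄)∑_{t=0}^{m−1} c₁^t [f(x^{m−1−t}) − f(x*)], where x^0 = x̃^r, x^1, …, x^m = x̃^{r+1} are the inner iterates of epoch r. Then, conditional on x̃^r, the expectation over the m independent uniformly random inner-loop indices (i.e. the average over all n^m index sequences) satisfies E[T^{r+1}] ≤ max{1/2, (1 − μ/(4L))^m} T^r. -/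
open scoped RealInnerProductSpace

/-- The SVRG inner iterate after `k` inner steps of an epoch with anchor `xt`,
step size `1/η` and index sequence `js`. -/
noncomputable def svrgIter (d n : ℕ) (η : ℝ)
    (f' : Fin n → EuclideanSpace ℝ (Fin d) → EuclideanSpace ℝ (Fin d))
    (xt : EuclideanSpace ℝ (Fin d)) (js : ℕ → Fin n) :
    ℕ → EuclideanSpace ℝ (Fin d)
  | 0 => xt
  | k + 1 =>
      svrgIter d n η f' xt js k
        - (1 / η) • (f' (js k) (svrgIter d n η f' xt js k) - f' (js k) xt
            + (1 / (n : ℝ)) • ∑ i, f' i xt)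

theorem svrg_descent {d : ℕ} {L : ℝ}
    {f : EuclideanSpace ℝ (Fin d) → ℝ} {f' : EuclideanSpace ℝ (Fin d) → EuclideanSpace ℝ (Fin d)}
    (hgrad : ∀ x, HasGradientAt f (f' x) x)
    (hsmooth : ∀ x y, ‖f' x - f' y‖ ≤ L * ‖x - y‖) (x u : EuclideanSpace ℝ (Fin d)) :
    f (x + u) ≤ f x + ⟪f' x, u⟫ + L / 2 * ‖u‖ ^ 2 := by
  have hd : ∀ t : ℝ, HasDerivAt
      (fun t : ℝ => t * ⟪f' x, u⟫ + L / 2 * t ^ 2 * ‖u‖ ^ 2 - f (x + t • u))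
      (⟪f' x, u⟫ + L * t * ‖u‖ ^ 2 - ⟪f' (x + t • u), u⟫) t := by
    intro t
    have h1 : HasDerivAt (fun t : ℝ => x + t • u) u t := by
      simpa using ((hasDerivAt_id t).smul_const u).const_add x
    have h2 := ((hgrad (x + t • u)).hasFDerivAt.comp_hasDerivAt t h1)
    have h3 : HasDerivAt (fun t : ℝ => f (x + t • u)) ⟪f' (x + t • u), u⟫ t := by
      simpa [Function.comp_def] using h2
    have h4 : HasDerivAt (fun t : ℝ => t * ⟪f' x, u⟫) (1 * ⟪f' x, u⟫) t :=
      (hasDerivAt_id t).mul_const _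
    have h5 : HasDerivAt (fun t : ℝ => L / 2 * t ^ 2 * ‖u‖ ^ 2)
        (L / 2 * (2 * t) * ‖u‖ ^ 2) t := by
      have := ((hasDerivAt_pow 2 t).const_mul (L / 2)).mul_const (‖u‖ ^ 2)
      simpa using this
    have h6 := (h4.add h5).sub h3
    have e : 1 * ⟪f' x, u⟫ + L / 2 * (2 * t) * ‖u‖ ^ 2 - ⟪f' (x + t • u), u⟫
        = ⟪f' x, u⟫ + L * t * ‖u‖ ^ 2 - ⟪f' (x + t • u), u⟫ := by ring
    rw [e] at h6
    exact h6
  have hmono : MonotoneOn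
      (fun t : ℝ => t * ⟪f' x, u⟫ + L / 2 * t ^ 2 * ‖u‖ ^ 2 - f (x + t • u)) (Set.Icc 0 1) := by
    apply monotoneOn_of_deriv_nonneg (convex_Icc 0 1)
    · exact fun t _ => (hd t).continuousAt.continuousWithinAt
    · exact fun t _ => (hd t).differentiableAt.differentiableWithinAt
    · intro t ht
      rw [interior_Icc] at ht
      rw [(hd t).deriv]
      have h1 : ⟪f' (x + t • u) - f' x, u⟫ ≤ ‖f' (x + t • u) - f' x‖ * ‖u‖ :=
        real_inner_le_norm _ _
      have h2 := hsmooth (x + t • u) x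
      rw [add_sub_cancel_left, norm_smul, Real.norm_eq_abs, abs_of_pos ht.1] at h2
      have h3 := mul_le_mul_of_nonneg_right h2 (norm_nonneg u)
      rw [inner_sub_left] at h1
      nlinarith
  have := hmono (Set.left_mem_Icc.2 zero_le_one) (Set.right_mem_Icc.2 zero_le_one) zero_le_one
  simp at this
  linarith

theorem svrg_coco {d : ℕ} {L μ : ℝ} (hμL : μ ≤ L)
    {f : EuclideanSpace ℝ (Fin d) → ℝ} {f' : EuclideanSpace ℝ (Fin d) → EuclideanSpace ℝ (Fin d)}
    (hgrad : ∀ x, HasGradientAt f (f' x) x)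
    (hsmooth : ∀ x y, ‖f' x - f' y‖ ≤ L * ‖x - y‖)
    (hsc : ∀ x y, f x ≥ f y + ⟪f' y, x - y⟫ + μ / 2 * ‖x - y‖ ^ 2)
    (x y : EuclideanSpace ℝ (Fin d)) :
    ‖f' x - f' y - μ • (x - y)‖ ^ 2
      ≤ 2 * (L - μ) * (f x - f y - ⟪f' y, x - y⟫ - μ / 2 * ‖x - y‖ ^ 2) := by
  set p := f' x - f' y - μ • (x - y) with hp
  set D := f x - f y - ⟪f' y, x - y⟫ - μ / 2 * ‖x - y‖ ^ 2 with hD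
  have key : ∀ t : ℝ, 0 ≤ D - t * ‖p‖ ^ 2 + (L - μ) / 2 * t ^ 2 * ‖p‖ ^ 2 := by
    intro t
    have h1 := svrg_descent hgrad hsmooth x (-(t • p))
    have h2 := hsc (x + -(t • p)) y
    have e1 : x + -(t • p) - y = (x - y) - t • p := by abel
    rw [e1, norm_sub_sq_real, inner_sub_right, inner_smul_right, inner_smul_right, norm_smul,
      mul_pow, Real.norm_eq_abs, sq_abs] at h2
    rw [norm_neg, norm_smul, inner_neg_right, inner_smul_right, mul_pow, Real.norm_eq_abs,
      sq_abs] at h1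
    have h3 : ‖p‖ ^ 2 = ⟪f' x, p⟫ - ⟪f' y, p⟫ - μ * ⟪x - y, p⟫ := by
      rw [← real_inner_self_eq_norm_sq]
      nth_rewrite 1 [hp]
      rw [inner_sub_left, inner_sub_left, inner_smul_left]
      simp
    have h4 : t * ‖p‖ ^ 2 = t * (⟪f' x, p⟫ - ⟪f' y, p⟫ - μ * ⟪x - y, p⟫) := by rw [h3]
    rw [h4, hD]
    linarith
  have hp0 := sq_nonneg ‖p‖
  rcases hμL.eq_or_lt with h | h
  · subst h
    by_contra hc
    simp only [sub_self, mul_zero, zero_mul, not_le] at hc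
    have := key ((D + 1) / ‖p‖ ^ 2)
    rw [div_mul_cancel₀ _ hc.ne'] at this
    simp at this
    linarith
  · have hM : 0 < L - μ := by linarith
    have := key (1 / (L - μ))
    have e : (L - μ) * (D - 1 / (L - μ) * ‖p‖ ^ 2
        + (L - μ) / 2 * (1 / (L - μ)) ^ 2 * ‖p‖ ^ 2) = (L - μ) * D - ‖p‖ ^ 2 / 2 := by
      field_simp
      ring
    have := mul_nonneg hM.le this
    rw [e] at this
    linarith

theorem svrg_star {d n : ℕ} (hn : 0 < n) {L : ℝ} (hL : 0 < L)
    {f : Fin n → EuclideanSpace ℝ (Fin d) → ℝ}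
    {f' : Fin n → EuclideanSpace ℝ (Fin d) → EuclideanSpace ℝ (Fin d)}
    (hgrad : ∀ i x, HasGradientAt (f i) (f' i x) x)
    (hsmooth : ∀ i x y, ‖f' i x - f' i y‖ ≤ L * ‖x - y‖)
    (xstar : EuclideanSpace ℝ (Fin d))
    (hstar : ∀ x, (1 / (n : ℝ)) * ∑ i, f i xstar ≤ (1 / (n : ℝ)) * ∑ i, f i x) :
    ∑ i, f' i xstar = 0 := by
  have hn' : (0 : ℝ) < n := by exact_mod_cast hn
  set g := ∑ i, f' i xstar with hg
  have h := fun t : ℝ => le_of_mul_le_mul_left (hstar (xstar + -(t • g))) (by positivity)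
  have h2 : ∀ t : ℝ, ∑ i, f i (xstar + -(t • g))
      ≤ ∑ i, f i xstar - t * ‖g‖ ^ 2 + n * (L / 2 * (t ^ 2 * ‖g‖ ^ 2)) := by
    intro t
    have := Finset.sum_le_sum (s := Finset.univ) fun i _ =>
      svrg_descent (hgrad i) (hsmooth i) xstar (-(t • g))
    rw [Finset.sum_add_distrib, Finset.sum_add_distrib, ← sum_inner, ← hg, inner_neg_right,
      inner_smul_right, real_inner_self_eq_norm_sq, norm_neg, norm_smul, mul_pow,
      Real.norm_eq_abs, sq_abs] at this
    simp at this
    linarith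
  have h3 := (h (1 / (n * L))).trans (h2 (1 / (n * L)))
  have e : (n : ℝ) * (L / 2 * ((1 / (n * L)) ^ 2 * ‖g‖ ^ 2)) = 1 / (n * L) * ‖g‖ ^ 2 / 2 := by
    field_simp
  rw [e] at h3
  have h4 : 1 / (n * L) * ‖g‖ ^ 2 ≤ 0 := by linarith
  have h5 : 0 < 1 / (n * L) := by positivity
  have h6 : ‖g‖ ^ 2 ≤ 0 := by
    by_contra hc
    push Not at hc
    have := mul_pos h5 hc
    linarith
  have : ‖g‖ = 0 := by nlinarith [norm_nonneg g]
  exact norm_eq_zero.1 this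

/-- Pointwise vector inequality: `v = p + μ e - w`. -/
theorem svrg_vec {d : ℕ} (μ : ℝ) (p e w : EuclideanSpace ℝ (Fin d)) :
    ‖p + μ • e - w‖ ^ 2
      ≤ 3 * ‖p‖ ^ 2 + 2 * ‖w‖ ^ 2 + 2 * μ ^ 2 * ‖e‖ ^ 2 - 2 * μ * ⟪e, w⟫ := by
  have h1 : 0 ≤ ‖p + w‖ ^ 2 := sq_nonneg _
  have h2 : 0 ≤ ‖p - μ • e‖ ^ 2 := sq_nonneg _
  rw [norm_add_sq_real] at h1
  rw [norm_sub_sq_real, inner_smul_right, norm_smul, mul_pow, Real.norm_eq_abs, sq_abs] at h2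
  rw [norm_sub_sq_real, norm_add_sq_real, inner_add_left, inner_smul_left, inner_smul_right,
    norm_smul, mul_pow, Real.norm_eq_abs, sq_abs]
  simp only [conj_trivial]
  linarith

theorem svrg_step {d n : ℕ} (hn : 0 < n) {μ L : ℝ}
    (hμ : 0 < μ) (hμL : μ ≤ L)
    {f : Fin n → EuclideanSpace ℝ (Fin d) → ℝ}
    {f' : Fin n → EuclideanSpace ℝ (Fin d) → EuclideanSpace ℝ (Fin d)}
    (hgrad : ∀ i x, HasGradientAt (f i) (f' i x) x)
    (hsmooth : ∀ i x y, ‖f' i x - f' i y‖ ≤ L * ‖x - y‖)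
    (hsc : ∀ i x y, f i x ≥ f i y + ⟪f' i y, x - y⟫ + μ / 2 * ‖x - y‖ ^ 2)
    (xstar : EuclideanSpace ℝ (Fin d))
    (hs0 : ∑ i, f' i xstar = 0)
    (xt x : EuclideanSpace ℝ (Fin d)) :
    ∑ j, ‖x - (1 / (4 * L)) • (f' j x - f' j xt + (1 / (n : ℝ)) • ∑ i, f' i xt) - xstar‖ ^ 2
      ≤ n * ((1 - μ / (4 * L) + μ ^ 2 / (8 * L ^ 2)) * ‖x - xstar‖ ^ 2)
        - 1 / (2 * L) * (∑ i, f i x - ∑ i, f i xstar)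
        + (L - μ) / (4 * L ^ 2) * (∑ i, f i xt - ∑ i, f i xstar) := by
  have hL : 0 < L := hμ.trans_le hμL
  have hn' : (0 : ℝ) < n := by exact_mod_cast hn
  set e := x - xstar with he
  set e0 := xt - xstar with he0
  set G := (1 / (n : ℝ)) • ∑ i, f' i xt with hG
  set qb := G - μ • e0 with hqb
  set s := 1 / (4 * L) with hs
  have hs_pos : 0 < s := by positivity
  have hsL : s * L = 1 / 4 := by rw [hs]; field_simp
  have hnG : ∑ i, f' i xt = (n : ℝ) • G := by
    rw [hG, smul_smul]; field_simp; simp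
  let q : Fin n → EuclideanSpace ℝ (Fin d) := fun j => f' j xt - f' j xstar - μ • e0
  have hq : ∑ j, q j = (n : ℝ) • qb := by
    simp only [q, Finset.sum_sub_distrib, hs0, hnG, hqb, Finset.sum_const, Finset.card_univ,
      Fintype.card_fin, smul_sub, sub_zero, Nat.cast_smul_eq_nsmul]
  have point : ∀ j, ‖x - s • (f' j x - f' j xt + G) - xstar‖ ^ 2 ≤
      ‖e‖ ^ 2 - 2 * s * (f j x - f j xstar - ⟪f' j xstar, e⟫ + μ / 2 * ‖e‖ ^ 2)
        + (2 * s - 2 * μ * s ^ 2) * (⟪e, q j⟫ - ⟪e, qb⟫)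
        + s ^ 2 * (2 * (2 * (L - μ) * (f j xt - f j xstar - ⟪f' j xstar, e0⟫)
            - 2 * ⟪qb, q j⟫ + ‖qb‖ ^ 2) + 2 * μ ^ 2 * ‖e‖ ^ 2) := by
    intro j
    set g := f' j x - f' j xstar with hg
    set p := g - μ • e with hp
    set w := q j - qb with hw
    have hv : f' j x - f' j xt + G = p + μ • e - w := by
      simp only [hp, hw, q, hqb, hg]; abel
    have e1 : x - s • (f' j x - f' j xt + G) - xstar = e - s • (p + μ • e - w) := by
      rw [hv, he]; abel
    have hV := svrg_vec μ p e w
    have hc1 := svrg_coco hμL (hgrad j) (hsmooth j) (hsc j) xstar x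
    have hc2 := svrg_coco hμL (hgrad j) (hsmooth j) (hsc j) xt xstar
    have e2 : f' j xstar - f' j x - μ • (xstar - x) = -p := by
      simp only [hp, hg, he, smul_sub]; abel
    have e3 : xstar - x = -e := by rw [he]; abel
    rw [e2, e3, norm_neg, norm_neg, inner_neg_right] at hc1
    have hqj : ‖q j‖ ^ 2 ≤ 2 * (L - μ) * (f j xt - f j xstar - ⟪f' j xstar, e0⟫) := by
      refine hc2.trans ?_
      have : 0 ≤ (L - μ) * (μ / 2 * ‖e0‖ ^ 2) :=
        mul_nonneg (by linarith) (by positivity)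
      rw [← he0]
      linarith
    have hA : 0 ≤ f j xstar - f j x - -⟪f' j x, e⟫ - μ / 2 * ‖e‖ ^ 2 := by
      have := hsc j xstar x
      rw [e3, norm_neg, inner_neg_right] at this
      linarith
    have hp2 : ‖p‖ ^ 2 ≤ 2 * L * (f j xstar - f j x - -⟪f' j x, e⟫ - μ / 2 * ‖e‖ ^ 2) := by
      refine hc1.trans ?_
      have := mul_nonneg hμ.le hA
      linarith
    have hw2 : ‖w‖ ^ 2 = ‖q j‖ ^ 2 - 2 * ⟪qb, q j⟫ + ‖qb‖ ^ 2 := by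
      rw [hw, norm_sub_sq_real, real_inner_comm]
    have hew : ⟪e, w⟫ = ⟪e, q j⟫ - ⟪e, qb⟫ := by rw [hw, inner_sub_right]
    have hev : ⟪e, p + μ • e - w⟫ = ⟪f' j x, e⟫ - ⟪f' j xstar, e⟫ - ⟪e, w⟫ := by
      have : p + μ • e = g := by rw [hp]; abel
      rw [this, inner_sub_right, hg, inner_sub_right, real_inner_comm e, real_inner_comm e]
    rw [e1, norm_sub_sq_real, inner_smul_right, norm_smul, mul_pow, Real.norm_eq_abs, sq_abs,
      hev]
    rw [hew] at hV ⊢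
    rw [hw2] at hV
    set P := ‖p‖ ^ 2 with hP
    have hV2 : ‖p + μ • e - w‖ ^ 2 ≤ 3 * P + 2 * (2 * (L - μ) *
        (f j xt - f j xstar - ⟪f' j xstar, e0⟫) - 2 * ⟪qb, q j⟫ + ‖qb‖ ^ 2)
        + 2 * μ ^ 2 * ‖e‖ ^ 2 - 2 * μ * (⟪e, q j⟫ - ⟪e, qb⟫) := by linarith
    have hV3 := mul_le_mul_of_nonneg_left hV2 (sq_nonneg s)
    -- s² * 3 P ≤ 2 s * A
    have hPb : s ^ 2 * (3 * P) ≤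
        2 * s * (f j xstar - f j x - -⟪f' j x, e⟫ - μ / 2 * ‖e‖ ^ 2) := by
      have h1 := mul_le_mul_of_nonneg_left hp2 (by positivity : 0 ≤ s ^ 2 * 3)
      have h2 : s ^ 2 * 3 * (2 * L * (f j xstar - f j x - -⟪f' j x, e⟫ - μ / 2 * ‖e‖ ^ 2))
          = 6 * s * (s * L) * (f j xstar - f j x - -⟪f' j x, e⟫ - μ / 2 * ‖e‖ ^ 2) := by ring
      rw [h2, hsL] at h1
      have := mul_nonneg hs_pos.le hA
      linarith
    linarith
  refine (Finset.sum_le_sum fun j _ => point j).trans ?_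
  have i1 : ∑ j, ⟪f' j xstar, e⟫ = 0 := by rw [← sum_inner, hs0, inner_zero_left]
  have i2 : ∑ j, ⟪f' j xstar, e0⟫ = 0 := by rw [← sum_inner, hs0, inner_zero_left]
  have i3 : ∑ j, ⟪e, q j⟫ = n * ⟪e, qb⟫ := by rw [← inner_sum, hq, inner_smul_right]
  have i4 : ∑ j, ⟪qb, q j⟫ = n * ‖qb‖ ^ 2 := by
    rw [← inner_sum, hq, inner_smul_right, real_inner_self_eq_norm_sq]
  simp only [Finset.sum_add_distrib, Finset.sum_sub_distrib, ← Finset.mul_sum, i1, i2, i3, i4,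
    Finset.sum_const, Finset.card_univ, Fintype.card_fin, nsmul_eq_mul]
  have hs2 : (L - μ) / (4 * L ^ 2) = s ^ 2 * (4 * (L - μ)) := by rw [hs]; field_simp; try ring
  have hs3 : 1 / (2 * L) = 2 * s := by rw [hs]; field_simp; try ring
  have hs4 : 1 - μ / (4 * L) + μ ^ 2 / (8 * L ^ 2) = 1 - μ * s + 2 * μ ^ 2 * s ^ 2 := by
    rw [hs]; field_simp; ring
  rw [hs2, hs3, hs4]
  have : 0 ≤ s ^ 2 * (n * ‖qb‖ ^ 2) := by positivity
  linarith

theorem svrgIter_congr {d n : ℕ} (η : ℝ)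
    (f' : Fin n → EuclideanSpace ℝ (Fin d) → EuclideanSpace ℝ (Fin d))
    (xt : EuclideanSpace ℝ (Fin d)) (js js' : ℕ → Fin n) (k : ℕ)
    (h : ∀ i < k, js i = js' i) : svrgIter d n η f' xt js k = svrgIter d n η f' xt js' k := by
  induction k with
  | zero => rfl
  | succ k ih =>
    simp only [svrgIter]
    rw [ih fun i hi => h i (by omega), h k (by omega)]

theorem svrg_resample {m n : ℕ} (k : Fin m) (Φ : (Fin m → Fin n) → Fin n → ℝ)
    (h : ∀ js j j', Φ (Function.update js k j') j = Φ js j) :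
    ∑ js, ∑ j, Φ js j = n * ∑ js, Φ js (js k) := by
  let T : (Fin m → Fin n) × Fin n → (Fin m → Fin n) × Fin n :=
    fun a => (Function.update a.1 k a.2, a.1 k)
  have hT : Function.Involutive T := by
    rintro ⟨js, j⟩
    simp [T]
  have h1 := Equiv.sum_comp (Function.Involutive.toPerm T hT) (fun a : (Fin m → Fin n) × Fin n => Φ a.1 a.2)
  have h2 : ∀ a : (Fin m → Fin n) × Fin n, Φ (Function.Involutive.toPerm T hT a).1 (Function.Involutive.toPerm T hT a).2 = Φ a.1 (a.1 k) := by
    rintro ⟨js, j⟩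
    simp [T, h]
  simp only [h2] at h1
  rw [Fintype.sum_prod_type, Fintype.sum_prod_type] at h1
  rw [← h1, Finset.mul_sum]
  simp

theorem svrg_unroll (m : ℕ) (c b : ℝ) (hc : 0 ≤ c) (a F : ℕ → ℝ)
    (h : ∀ k < m, a (k + 1) ≤ c * a k + (b - F k)) (k : ℕ) (hk : k ≤ m) :
    a k ≤ c ^ k * a 0 + ∑ t ∈ Finset.range k, c ^ t * (b - F (k - 1 - t)) := by
  induction k with
  | zero => simp
  | succ k ih =>
    have h1 := h k (by omega)
    have h2 := mul_le_mul_of_nonneg_left (ih (by omega)) hc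
    rw [Finset.sum_range_succ']
    have h3 : ∑ t ∈ Finset.range k, c ^ (t + 1) * (b - F (k + 1 - 1 - (t + 1)))
        = c * ∑ t ∈ Finset.range k, c ^ t * (b - F (k - 1 - t)) := by
      rw [Finset.mul_sum]
      refine Finset.sum_congr rfl fun t _ => ?_
      have : k + 1 - 1 - (t + 1) = k - 1 - t := by omega
      rw [this]; ring
    rw [h3]
    simp only [pow_zero, Nat.add_sub_cancel, Nat.sub_zero, one_mul]
    calc a (k + 1) ≤ _ := h1
      _ ≤ _ := by rw [pow_succ]; linarith

theorem svrg_epoch_contraction (d n m : ℕ) (hn : 0 < n) (μ L : ℝ)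
    (hμ : 0 < μ) (hμL : μ ≤ L)
    (f : Fin n → EuclideanSpace ℝ (Fin d) → ℝ)
    (f' : Fin n → EuclideanSpace ℝ (Fin d) → EuclideanSpace ℝ (Fin d))
    (hgrad : ∀ i x, HasGradientAt (f i) (f' i x) x)
    (hsmooth : ∀ i x y, ‖f' i x - f' i y‖ ≤ L * ‖x - y‖)
    (hsc : ∀ i x y, f i x ≥ f i y + ⟪f' i y, x - y⟫ + μ / 2 * ‖x - y‖ ^ 2)
    (xstar : EuclideanSpace ℝ (Fin d))
    (hstar : ∀ x, (1 / (n : ℝ)) * ∑ i, f i xstar ≤ (1 / (n : ℝ)) * ∑ i, f i x)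
    (xt : EuclideanSpace ℝ (Fin d))
    (hassume : ∀ js : ℕ → Fin n,
      (1 / (n : ℝ)) * ∑ i, f i (svrgIter d n (4 * L) f' xt js m)
          - (1 / (n : ℝ)) * ∑ i, f i xstar
        ≤ (1 / ∑ t ∈ Finset.range m, (1 - μ / (4 * L)) ^ t) *
            ∑ t ∈ Finset.range m, (1 - μ / (4 * L)) ^ t *
              ((1 / (n : ℝ)) * ∑ i, f i (svrgIter d n (4 * L) f' xt js (m - 1 - t))
                - (1 / (n : ℝ)) * ∑ i, f i xstar)) :
    (1 / (n : ℝ) ^ m) * ∑ js : Fin m → Fin n,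
        (‖svrgIter d n (4 * L) f' xt (extSeq hn js) m - xstar‖ ^ 2
          + ((∑ t ∈ Finset.range m, (1 - μ / (4 * L)) ^ t) / (2 * L)) *
            ((1 / (n : ℝ)) * ∑ i, f i (svrgIter d n (4 * L) f' xt (extSeq hn js) m)
              - (1 / (n : ℝ)) * ∑ i, f i xstar))
      ≤ max (1 / 2) ((1 - μ / (4 * L)) ^ m) *
          (‖xt - xstar‖ ^ 2
            + ((∑ t ∈ Finset.range m, (1 - μ / (4 * L)) ^ t) / (2 * L)) *
              ((1 / (n : ℝ)) * ∑ i, f i xt - (1 / (n : ℝ)) * ∑ i, f i xstar)) := by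
  have hL : 0 < L := hμ.trans_le hμL
  have hn' : (0 : ℝ) < n := by exact_mod_cast hn
  have hs0 := svrg_star hn hL hgrad hsmooth xstar hstar
  set c := 1 - μ / (4 * L) with hc
  have hc0 : 0 < c := by
    rw [hc, sub_pos, div_lt_one (by positivity)]
    linarith
  set C := ∑ t ∈ Finset.range m, c ^ t with hC
  have hC0 : 0 ≤ C := Finset.sum_nonneg fun t _ => by positivity
  let F : EuclideanSpace ℝ (Fin d) → ℝ := fun x =>
    (1 / (n : ℝ)) * ∑ i, f i x - (1 / (n : ℝ)) * ∑ i, f i xstar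
  have hFdef : ∀ x, (1 / (n : ℝ)) * ∑ i, f i x - (1 / (n : ℝ)) * ∑ i, f i xstar = F x :=
    fun _ => rfl
  simp only [hFdef] at hassume ⊢
  have hFsc : ∀ x, μ / 2 * ‖x - xstar‖ ^ 2 ≤ F x := by
    intro x
    have := Finset.sum_le_sum (s := Finset.univ) fun i _ => hsc i x xstar
    simp only [Finset.sum_add_distrib, ← sum_inner, hs0, inner_zero_left, Finset.sum_const,
      Finset.card_univ, Fintype.card_fin, nsmul_eq_mul, add_zero] at this
    have h2 := mul_le_mul_of_nonneg_left this (by positivity : 0 ≤ 1 / (n : ℝ))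
    rw [mul_add, ← mul_assoc (1 / (n : ℝ)) (n : ℝ), one_div_mul_cancel hn'.ne'] at h2
    simp only [F]
    linarith
  set X : (Fin m → Fin n) → ℕ → EuclideanSpace ℝ (Fin d) := fun js k =>
    svrgIter d n (4 * L) f' xt (extSeq hn js) k with hX
  let N : ℝ := 1 / (n : ℝ) ^ m
  have hN : 0 < N := by positivity
  let a : ℕ → ℝ := fun k => N * ∑ js, ‖X js k - xstar‖ ^ 2
  let B : ℕ → ℝ := fun k => N * ∑ js, F (X js k)
  have hN1 : ∀ z : ℝ, N * ∑ _js : Fin m → Fin n, z = z := by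
    intro z
    simp [N]
    field_simp
  have ha0 : a 0 = ‖xt - xstar‖ ^ 2 := hN1 (‖xt - xstar‖ ^ 2)
  have hstep : ∀ k < m, a (k + 1) ≤ (c + μ ^ 2 / (8 * L ^ 2)) * a k - 1 / (2 * L) * B k
      + (L - μ) / (4 * L ^ 2) * F xt := by
    intro k hk
    have h1 := svrg_resample (⟨k, hk⟩ : Fin m) (fun js j =>
      ‖X js k - (1 / (4 * L)) • (f' j (X js k) - f' j xt
        + (1 / (n : ℝ)) • ∑ i, f' i xt) - xstar‖ ^ 2) (by
        intro js j j'
        have : X (Function.update js ⟨k, hk⟩ j') k = X js k := by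
          apply svrgIter_congr
          intro i hi
          simp only [extSeq]
          have him : i < m := by omega
          rw [dif_pos him, dif_pos him, Function.update_of_ne]
          intro h
          have := congrArg Fin.val h
          simp at this
          omega
        simp only [this])
    have h2 : ∀ js : Fin m → Fin n, X js (k + 1) = X js k - (1 / (4 * L)) •
        (f' (js ⟨k, hk⟩) (X js k) - f' (js ⟨k, hk⟩) xt + (1 / (n : ℝ)) • ∑ i, f' i xt) := by
      intro js
      have : extSeq hn js k = js ⟨k, hk⟩ := by simp [extSeq, hk]
      simp only [hX, svrgIter, this]
    have h3 := Finset.sum_le_sum (s := Finset.univ) fun (js : Fin m → Fin n) _ =>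
      svrg_step hn hμ hμL hgrad hsmooth hsc xstar hs0 xt (X js k)
    rw [h1] at h3
    simp only [← h2] at h3
    have h4 : ∀ x, ∑ i, f i x - ∑ i, f i xstar = n * F x := by
      intro x
      simp only [F]
      field_simp
    simp only [h4] at h3
    have h5 : ∑ js : Fin m → Fin n, (n * ((1 - μ / (4 * L) + μ ^ 2 / (8 * L ^ 2))
          * ‖X js k - xstar‖ ^ 2) - 1 / (2 * L) * (n * F (X js k))
          + (L - μ) / (4 * L ^ 2) * (n * F xt))
        = n * ((c + μ ^ 2 / (8 * L ^ 2)) * ∑ js : Fin m → Fin n, ‖X js k - xstar‖ ^ 2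
          - 1 / (2 * L) * ∑ js : Fin m → Fin n, F (X js k)
          + (L - μ) / (4 * L ^ 2) * ∑ _js : Fin m → Fin n, F xt) := by
      simp only [Finset.sum_add_distrib, Finset.sum_sub_distrib, ← Finset.mul_sum, ← hc]
      ring
    rw [h5] at h3
    have h6 := mul_le_mul_of_nonneg_left (le_of_mul_le_mul_left h3 hn') hN.le
    have h7 := hN1 (F xt)
    simp only [a, B]
    refine h6.trans (le_of_eq ?_)
    linear_combination ((L - μ) / (4 * L ^ 2)) * h7
  have hBa : ∀ k, μ / 2 * a k ≤ B k := by
    intro k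
    have := mul_le_mul_of_nonneg_left (Finset.sum_le_sum (s := Finset.univ)
      fun (js : Fin m → Fin n) _ => hFsc (X js k)) hN.le
    rw [← Finset.mul_sum] at this
    simp only [a, B]
    linarith
  have hg0 : 0 ≤ F xt := le_trans (by positivity) (hFsc xt)
  have hbound : ∀ k ≤ m, μ * a k ≤ 2 * F xt := by
    intro k
    induction k with
    | zero =>
      intro _
      have := hFsc xt
      rw [ha0]; linarith
    | succ k ih =>
      intro hk
      have ih := ih (by omega)
      have h1 := hstep k (by omega)
      have h2 := hBa k
      obtain ⟨κ, hκ⟩ : ∃ κ, κ = μ / L := ⟨_, rfl⟩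
      have hκ0 : 0 < κ := by rw [hκ]; positivity
      have hκ1 : κ ≤ 1 := by rw [hκ, div_le_one hL]; exact hμL
      have h3 : 1 / (2 * L) * (μ / 2 * a k) ≤ 1 / (2 * L) * B k :=
        mul_le_mul_of_nonneg_left h2 (by positivity)
      have h4 : a (k + 1) ≤ (c + μ ^ 2 / (8 * L ^ 2)) * a k - 1 / (2 * L) * (μ / 2 * a k)
        + (L - μ) / (4 * L ^ 2) * F xt := by linarith
      have h5 := mul_le_mul_of_nonneg_left h4 hμ.le
      have h6 : μ * ((c + μ ^ 2 / (8 * L ^ 2)) * a k - 1 / (2 * L) * (μ / 2 * a k)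
        + (L - μ) / (4 * L ^ 2) * F xt)
          = (1 - κ / 2 + κ ^ 2 / 8) * (μ * a k) + κ * (1 - κ) / 4 * F xt := by
        rw [hκ, hc]; field_simp; ring
      rw [h6] at h5
      have h7 : (1 - κ / 2 + κ ^ 2 / 8) * (μ * a k) ≤ (1 - κ / 2 + κ ^ 2 / 8) * (2 * F xt) :=
        mul_le_mul_of_nonneg_left ih (by nlinarith)
      have h8 : 0 ≤ κ * F xt := by positivity
      nlinarith
  have hstep2 : ∀ k < m, a (k + 1) ≤ c * a k + (1 / (4 * L) * F xt - 1 / (2 * L) * B k) := by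
    intro k hk
    have h1 := hstep k hk
    have h2 := mul_le_mul_of_nonneg_left (hbound k hk.le)
      (by positivity : 0 ≤ μ / (8 * L ^ 2))
    have h3 : μ / (8 * L ^ 2) * (2 * F xt) + (L - μ) / (4 * L ^ 2) * F xt
        = 1 / (4 * L) * F xt := by field_simp; ring
    have h4 : μ / (8 * L ^ 2) * (μ * a k) = μ ^ 2 / (8 * L ^ 2) * a k := by ring
    linarith
  have hun := svrg_unroll m c (1 / (4 * L) * F xt) hc0.le a (fun k => 1 / (2 * L) * B k)
    hstep2 m le_rfl
  have hsum : ∑ t ∈ Finset.range m, c ^ t * (1 / (4 * L) * F xt - 1 / (2 * L) * B (m - 1 - t))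
      = C * (1 / (4 * L) * F xt)
        - 1 / (2 * L) * ∑ t ∈ Finset.range m, c ^ t * B (m - 1 - t) := by
    rw [hC, Finset.sum_mul, Finset.mul_sum, ← Finset.sum_sub_distrib]
    refine Finset.sum_congr rfl fun t _ => ?_
    ring
  rw [hsum, ha0] at hun
  have hCB : C * B m ≤ ∑ t ∈ Finset.range m, c ^ t * B (m - 1 - t) := by
    have h1 : ∀ js : Fin m → Fin n,
        C * F (X js m) ≤ ∑ t ∈ Finset.range m, c ^ t * F (X js (m - 1 - t)) := by
      intro js
      rcases Nat.eq_zero_or_pos m with h0 | h0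
      · subst h0
        simp [hC]
      · have hCp : 0 < C := Finset.sum_pos (fun t _ => by positivity) ⟨0, by simpa using h0⟩
        have := mul_le_mul_of_nonneg_left (hassume (extSeq hn js)) hCp.le
        rwa [← mul_assoc, mul_one_div_cancel hCp.ne', one_mul] at this
    have h2 := mul_le_mul_of_nonneg_left (Finset.sum_le_sum (s := Finset.univ)
      fun (js : Fin m → Fin n) _ => h1 js) hN.le
    rw [← Finset.mul_sum, Finset.sum_comm, Finset.mul_sum (Finset.range m)] at h2
    simp only [B]
    calc C * (N * ∑ js, F (X js m)) = N * (C * ∑ js, F (X js m)) := by ring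
      _ ≤ _ := h2
      _ = _ := by
        refine Finset.sum_congr rfl fun t _ => ?_
        rw [← Finset.mul_sum]; ring
  have hlhs : N * ∑ js : Fin m → Fin n, (‖X js m - xstar‖ ^ 2 + C / (2 * L) * F (X js m))
      = a m + 1 / (2 * L) * (C * B m) := by
    rw [Finset.sum_add_distrib, ← Finset.mul_sum]
    simp only [a, B]
    ring
  change N * ∑ js : Fin m → Fin n, (‖X js m - xstar‖ ^ 2 + C / (2 * L) * F (X js m)) ≤ _
  rw [hlhs]
  have h1 := mul_le_mul_of_nonneg_left hCB (by positivity : 0 ≤ 1 / (2 * L))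
  have h2 : C * (1 / (4 * L) * F xt) = 1 / 2 * (C / (2 * L) * F xt) := by field_simp; ring
  have h3 := mul_le_mul_of_nonneg_right (le_max_left (1 / 2) (c ^ m))
    (by positivity : 0 ≤ C / (2 * L) * F xt)
  have h4 := mul_le_mul_of_nonneg_right (le_max_right (1 / 2) (c ^ m))
    (by positivity : 0 ≤ ‖xt - xstar‖ ^ 2)
  rw [mul_add]
  linarith
end

section
/- Initialize the MISO table with φ_i^0 = φ^0 for all i and run k MISO update steps, choosing the index at each step independently and uniformly at random from {1,…,n} (so E below is the average over all n^k index sequences). Then, with w^k the MISO point after k updates and w* the unique minimizer of f: E[f(w^k)] − f(w*) ≤ (1 − μ/((μ + L)n))^{2k} · (2n/μ) · ‖∇f(φ^0)‖². -/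
open scoped RealInnerProductSpace

/-- The MISO point associated with a table `φ`. -/
noncomputable def misoW (d n : ℕ) (L : ℝ)
    (f' : Fin n → EuclideanSpace ℝ (Fin d) → EuclideanSpace ℝ (Fin d))
    (φ : Fin n → EuclideanSpace ℝ (Fin d)) : EuclideanSpace ℝ (Fin d) :=
  (1 / (n : ℝ)) • ∑ i, φ i - (1 / (L * n)) • ∑ i, f' i (φ i)

/-- The MISO table after `k` update steps with index sequence `js`:
at each step the chosen table entry is replaced by the current MISO point. -/
noncomputable def misoIter (d n : ℕ) (L : ℝ)
    (f' : Fin n → EuclideanSpace ℝ (Fin d) → EuclideanSpace ℝ (Fin d))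
    (φ0 : Fin n → EuclideanSpace ℝ (Fin d)) (js : ℕ → Fin n) :
    ℕ → Fin n → EuclideanSpace ℝ (Fin d)
  | 0 => φ0
  | k + 1 =>
      Function.update (misoIter d n L f' φ0 js k) (js k)
        (misoW d n L f' (misoIter d n L f' φ0 js k))

lemma seq_bound (x b : ℕ → ℝ) (s N : ℝ) (hs : 3 / 4 ≤ s) (hs1 : s < 1)
    (hx0 : ∀ k, 0 ≤ x k) (hb : ∀ k, b (k + 1) ≤ b k)
    (h1 : ∀ k, x (k + 1) ≤ s * x k - 2 * (1 - s) * b k)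
    (h2 : ∀ k, x (k + 1) ≤ s ^ 2 * x k) (hxN : x 0 ≤ N) (hbN : b 0 ≤ N / 2) (k : ℕ) :
    b k ≤ 4 * N * s ^ (2 * k) := by
  have hN : 0 ≤ N := (hx0 0).trans hxN
  have s0 : 0 < s := by linarith
  have hanti : Antitone b := antitone_nat_of_succ_le hb
  have hxk : ∀ k, x k ≤ N * s ^ (2 * k) := by
    intro k
    induction k with
    | zero => simpa using hxN
    | succ k ih =>
      calc x (k + 1) ≤ s ^ 2 * x k := h2 k
        _ ≤ s ^ 2 * (N * s ^ (2 * k)) := by gcongr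
        _ = _ := by ring
  have hwin : ∀ p m, x (p + m) ≤ s ^ m * x p - 2 * (1 - s ^ m) * b (p + m) := by
    intro p m
    induction m with
    | zero => simp
    | succ m ih =>
      have e1 := h1 (p + m)
      have e2 : b (p + (m + 1)) ≤ b (p + m) := hb (p + m)
      have e3 : x (p + (m + 1)) ≤ s * x (p + m) - 2 * (1 - s) * b (p + m) := e1
      have hpm : s ^ (m + 1) ≤ 1 := pow_le_one₀ s0.le hs1.le
      have e4 : s * x (p + m) ≤ s * (s ^ m * x p - 2 * (1 - s ^ m) * b (p + m)) := by gcongr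
      have e5 : 2 * (1 - s ^ (m + 1)) * b (p + (m + 1)) ≤ 2 * (1 - s ^ (m + 1)) * b (p + m) := by
        apply mul_le_mul_of_nonneg_left e2; linarith
      rw [pow_succ] at *
      nlinarith
  by_cases hk : 1 / 2 ≤ s ^ k
  · have e1 : b k ≤ N / 2 := (hanti (Nat.zero_le k)).trans hbN
    have e2 : (1 / 4 : ℝ) ≤ s ^ (2 * k) := by
      rw [mul_comm, pow_mul]; nlinarith
    nlinarith
  · push Not at hk
    have hex : ∃ m, s ^ m < 1 / 2 := ⟨k, hk⟩
    classical
    set m := Nat.find hex with hm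
    have hm1 : s ^ m < 1 / 2 := Nat.find_spec hex
    have hmk : m ≤ k := Nat.find_min' hex hk
    have hm2 : 3 / 8 ≤ s ^ m := by
      rcases hmm : m with _ | m'
      · simp
        norm_num
      · have : ¬ s ^ m' < 1 / 2 := Nat.find_min hex (by omega)
        push Not at this
        rw [pow_succ]; nlinarith
    obtain ⟨p, rfl⟩ := Nat.exists_eq_add_of_le hmk
    have e1 := hwin p m
    rw [add_comm p m] at e1
    have e2 := hx0 (m + p)
    have e3 := hxk p
    have e4 : s ^ (2 * (m + p)) = (s ^ m) ^ 2 * s ^ (2 * p) := by ring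
    rw [e4]
    set θ := s ^ m
    set y := N * s ^ (2 * p) with hy
    have hy0 : 0 ≤ y := by positivity
    have e5 : 2 * (1 - θ) * b (m + p) ≤ θ * y := by nlinarith
    have e6 : θ * y ≤ 2 * (1 - θ) * (4 * θ ^ 2 * y) := by
      have : 1 ≤ 8 * (1 - θ) * θ := by nlinarith
      have h0 : 0 ≤ θ * y := by positivity
      nlinarith
    have e7 : b (m + p) ≤ 4 * θ ^ 2 * y := by
      refine le_of_mul_le_mul_left (e5.trans e6) (by linarith)
    calc b (m + p) ≤ _ := e7
      _ = _ := by rw [hy]; ring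

/-- Descent lemma. -/
lemma descent {d : ℕ} (L : ℝ) (g : EuclideanSpace ℝ (Fin d) → ℝ)
    (g' : EuclideanSpace ℝ (Fin d) → EuclideanSpace ℝ (Fin d))
    (hgrad : ∀ x, HasGradientAt g (g' x) x)
    (hsm : ∀ x y, ‖g' x - g' y‖ ≤ L * ‖x - y‖) (x z : EuclideanSpace ℝ (Fin d)) :
    g z ≤ g x + ⟪g' x, z - x⟫ + L / 2 * ‖z - x‖ ^ 2 := by
  set v := z - x with hv
  let h : ℝ → ℝ := fun t => g (x + t • v) - t * ⟪g' x, v⟫ - L / 2 * ‖v‖ ^ 2 * t ^ 2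
  have hd : ∀ t, HasDerivAt h (⟪g' (x + t • v), v⟫ - ⟪g' x, v⟫ - L * ‖v‖ ^ 2 * t) t := by
    intro t
    have hl : HasDerivAt (fun t : ℝ => x + t • v) v t := by
      simpa using ((hasDerivAt_id t).smul_const v).const_add x
    have h1 := (hgrad (x + t • v)).hasFDerivAt.comp_hasDerivAt t hl
    have h2 : HasDerivAt (fun t : ℝ => t * ⟪g' x, v⟫) ⟪g' x, v⟫ t := by
      simpa using (hasDerivAt_id t).mul_const ⟪g' x, v⟫
    have h3 : HasDerivAt (fun t : ℝ => L / 2 * ‖v‖ ^ 2 * t ^ 2) (L * ‖v‖ ^ 2 * t) t := by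
      have := (hasDerivAt_pow 2 t).const_mul (L / 2 * ‖v‖ ^ 2)
      refine this.congr_deriv ?_
      norm_num
      ring
    have := (h1.sub h2).sub h3
    exact this.congr_deriv (by simp)
  have hanti : AntitoneOn h (Set.Icc 0 1) := by
    apply antitoneOn_of_deriv_nonpos (convex_Icc 0 1)
    · exact fun t _ => (hd t).continuousAt.continuousWithinAt
    · exact fun t _ => (hd t).differentiableAt.differentiableWithinAt
    · intro t ht
      rw [interior_Icc] at ht
      rw [(hd t).deriv, ← inner_sub_left]
      have h1 := real_inner_le_norm (g' (x + t • v) - g' x) v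
      have h2 := hsm (x + t • v) x
      rw [add_sub_cancel_left, norm_smul, Real.norm_of_nonneg ht.1.le] at h2
      have := mul_le_mul_of_nonneg_right h2 (norm_nonneg v)
      nlinarith
  have := hanti (Set.left_mem_Icc.2 zero_le_one) (Set.right_mem_Icc.2 zero_le_one) zero_le_one
  simp only [h, one_smul, zero_smul, add_zero] at this
  rw [show x + v = z by simp [hv]] at this
  linarith

lemma misoIter_congr (d n : ℕ) (L : ℝ)
    (f' : Fin n → EuclideanSpace ℝ (Fin d) → EuclideanSpace ℝ (Fin d))
    (φ0 : Fin n → EuclideanSpace ℝ (Fin d)) (js js' : ℕ → Fin n) (k : ℕ)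
    (h : ∀ t < k, js t = js' t) :
    misoIter d n L f' φ0 js k = misoIter d n L f' φ0 js' k := by
  induction k with
  | zero => rfl
  | succ k ih =>
    simp only [misoIter]
    rw [ih (fun t ht => h t (by omega)), h k (by omega)]

/-- Expectation of a table functional after `k` steps. -/
noncomputable def expK (d n : ℕ) (hn : 0 < n) (L : ℝ)
    (f' : Fin n → EuclideanSpace ℝ (Fin d) → EuclideanSpace ℝ (Fin d))
    (φ0 : Fin n → EuclideanSpace ℝ (Fin d)) (k : ℕ)
    (Ψ : (Fin n → EuclideanSpace ℝ (Fin d)) → ℝ) : ℝ :=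
  (1 / (n : ℝ) ^ k) * ∑ js : Fin k → Fin n, Ψ (misoIter d n L f' φ0 (extSeq hn js) k)

section
variable {d n : ℕ} (hn : 0 < n) (L : ℝ)
    (f' : Fin n → EuclideanSpace ℝ (Fin d) → EuclideanSpace ℝ (Fin d))
    (φ0 : Fin n → EuclideanSpace ℝ (Fin d))

lemma expK_succ (k : ℕ) (Ψ : (Fin n → EuclideanSpace ℝ (Fin d)) → ℝ) :
    expK d n hn L f' φ0 (k + 1) Ψ = expK d n hn L f' φ0 k
      (fun φ => (1 / (n : ℝ)) * ∑ j, Ψ (Function.update φ j (misoW d n L f' φ))) := by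
  unfold expK
  have hstep : ∀ (j : Fin n) (js : Fin k → Fin n),
      misoIter d n L f' φ0 (extSeq hn (Fin.snoc js j : Fin (k + 1) → Fin n)) (k + 1) =
      Function.update (misoIter d n L f' φ0 (extSeq hn js) k) j
        (misoW d n L f' (misoIter d n L f' φ0 (extSeq hn js) k)) := by
    intro j js
    have h1 : misoIter d n L f' φ0 (extSeq hn (Fin.snoc js j : Fin (k + 1) → Fin n)) k =
        misoIter d n L f' φ0 (extSeq hn js) k := by
      apply misoIter_congr
      intro t ht
      simp [extSeq, ht, Nat.lt_succ_of_lt ht, Fin.snoc]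
    have h2 : extSeq hn (Fin.snoc js j : Fin (k + 1) → Fin n) k = j := by
      simp [extSeq, Fin.snoc]
    simp only [misoIter]
    rw [h1, h2]
  rw [← (Fin.snocEquiv (fun _ : Fin (k + 1) => Fin n)).sum_comp, Fintype.sum_prod_type,
    Finset.sum_comm, ← Finset.mul_sum, ← mul_assoc]
  congr 1
  · rw [pow_succ]; field_simp
  · refine Finset.sum_congr rfl fun js _ => Finset.sum_congr rfl fun j _ => ?_
    rw [← hstep]; rfl

lemma expK_mono (k : ℕ) {Ψ Φ : (Fin n → EuclideanSpace ℝ (Fin d)) → ℝ} (h : ∀ φ, Ψ φ ≤ Φ φ) :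
    expK d n hn L f' φ0 k Ψ ≤ expK d n hn L f' φ0 k Φ := by
  unfold expK
  gcongr
  exact h _

lemma expK_lin (k : ℕ) (a b : ℝ) (Ψ Φ : (Fin n → EuclideanSpace ℝ (Fin d)) → ℝ) :
    expK d n hn L f' φ0 k (fun φ => a * Ψ φ + b * Φ φ) =
      a * expK d n hn L f' φ0 k Ψ + b * expK d n hn L f' φ0 k Φ := by
  unfold expK
  rw [Finset.sum_add_distrib, ← Finset.mul_sum, ← Finset.mul_sum]
  ring

lemma expK_const (k : ℕ) (c : ℝ) : expK d n hn L f' φ0 k (fun _ => c) = c := by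
  unfold expK
  have : (n : ℝ) ≠ 0 := by positivity
  simp
  field_simp

lemma expK_zero (Ψ : (Fin n → EuclideanSpace ℝ (Fin d)) → ℝ) :
    expK d n hn L f' φ0 0 Ψ = Ψ φ0 := by
  simp [expK, misoIter]
end

/-- Surrogate. -/
noncomputable def surB (d n : ℕ) (L : ℝ) (f : Fin n → EuclideanSpace ℝ (Fin d) → ℝ)
    (f' : Fin n → EuclideanSpace ℝ (Fin d) → EuclideanSpace ℝ (Fin d))
    (φ : Fin n → EuclideanSpace ℝ (Fin d)) (x : EuclideanSpace ℝ (Fin d)) : ℝ :=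
  (1 / (n : ℝ)) * ∑ i, (f i (φ i) + ⟪f' i (φ i), x - φ i⟫ + L / 2 * ‖x - φ i‖ ^ 2)

lemma surB_eq (d n : ℕ) (hn : 0 < n) (L : ℝ) (hL : 0 < L)
    (f : Fin n → EuclideanSpace ℝ (Fin d) → ℝ)
    (f' : Fin n → EuclideanSpace ℝ (Fin d) → EuclideanSpace ℝ (Fin d))
    (φ : Fin n → EuclideanSpace ℝ (Fin d)) (x : EuclideanSpace ℝ (Fin d)) :
    surB d n L f f' φ x = surB d n L f f' φ (misoW d n L f' φ)
      + L / 2 * ‖x - misoW d n L f' φ‖ ^ 2 := by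
  have hn' : (n : ℝ) ≠ 0 := by positivity
  set w := misoW d n L f' φ with hw
  have hz : ∑ i, (f' i (φ i) + L • (w - φ i)) = 0 := by
    rw [Finset.sum_add_distrib, ← Finset.smul_sum, Finset.sum_sub_distrib]
    simp only [Finset.sum_const, Finset.card_univ, Fintype.card_fin]
    rw [hw, misoW, ← Nat.cast_smul_eq_nsmul ℝ, smul_sub, smul_smul, smul_sub,
      smul_smul, smul_smul, mul_assoc, mul_assoc]
    rw [show L * ((n : ℝ) * (1 / n)) = L by field_simp,
      show L * (n * (1 / (L * n))) = 1 by field_simp]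
    simp
  have key : ∀ i, (f i (φ i) + ⟪f' i (φ i), x - φ i⟫ + L / 2 * ‖x - φ i‖ ^ 2) =
      (f i (φ i) + ⟪f' i (φ i), w - φ i⟫ + L / 2 * ‖w - φ i‖ ^ 2) +
      (⟪f' i (φ i) + L • (w - φ i), x - w⟫ + L / 2 * ‖x - w‖ ^ 2) := by
    intro i
    have e : x - φ i = (x - w) + (w - φ i) := by abel
    rw [e, norm_add_sq_real, inner_add_right, inner_add_left, inner_smul_left,
      real_inner_comm (x - w) (w - φ i)]
    simp
    ring
  unfold surB
  rw [Finset.sum_congr rfl fun i _ => key i, Finset.sum_add_distrib,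
    Finset.sum_add_distrib (f := fun i => ⟪f' i (φ i) + L • (w - φ i), x - w⟫),
    ← sum_inner, hz]
  rw [inner_zero_left, zero_add]
  simp only [Finset.sum_const, Finset.card_univ, Fintype.card_fin, nsmul_eq_mul]
  rw [mul_add]
  congr 1
  field_simp

lemma avg_update {n : ℕ} {E : Type*} (φ : Fin n → E) (w : E) (j : Fin n)
    (a : Fin n → E → ℝ) :
    ∑ i, a i (Function.update φ j w i) = (∑ i, a i (φ i)) + (a j w - a j (φ j)) := by
  have h1 := Finset.add_sum_erase Finset.univ (fun i => a i (Function.update φ j w i))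
    (Finset.mem_univ j)
  have h2 := Finset.add_sum_erase Finset.univ (fun i => a i (φ i)) (Finset.mem_univ j)
  have h3 : ∑ i ∈ Finset.univ.erase j, a i (Function.update φ j w i)
      = ∑ i ∈ Finset.univ.erase j, a i (φ i) := by
    refine Finset.sum_congr rfl fun i hi => ?_
    rw [Function.update_of_ne (Finset.ne_of_mem_erase hi)]
  simp only [Function.update_self] at h1
  rw [h3] at h1
  linarith

lemma gd_contract {d : ℕ} (μ L : ℝ) (hμ : 0 < μ) (hμL : μ ≤ L)
    (g : EuclideanSpace ℝ (Fin d) → ℝ)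
    (g' : EuclideanSpace ℝ (Fin d) → EuclideanSpace ℝ (Fin d))
    (hup : ∀ x z, g z ≤ g x + ⟪g' x, z - x⟫ + L / 2 * ‖z - x‖ ^ 2)
    (hsc : ∀ x y, g x ≥ g y + ⟪g' y, x - y⟫ + μ / 2 * ‖x - y‖ ^ 2)
    (x : EuclideanSpace ℝ (Fin d)) :
    ‖g' (x - (1 / L) • g' x)‖ ≤ (1 - μ / (μ + L)) * ‖g' x‖ := by
  have hL : 0 < L := by linarith
  set y := x - (1 / L) • g' x with hy
  set p := g' x with hp
  set q := g' y with hq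
  have hyx : y = x - (1 / L) • p := hy
  set z := x + (1 / L) • (q - p)
  set z' := y + (1 / L) • (p - q)
  have a1 := hup x z
  have a2 := hsc z y
  have a3 := hup y z'
  have a4 := hsc z' x
  rw [← hp] at a1 a4
  rw [← hq] at a2 a3
  have e1 : z - x = (1 / L) • (q - p) := by simp [z]
  have e2 : z - y = (1 / L) • q := by simp only [z, hyx]; module
  have e3 : z' - y = (1 / L) • (p - q) := by simp [z']
  have e4 : z' - x = -((1 / L) • q) := by simp only [z', hyx]; module
  rw [e1] at a1
  rw [e2] at a2
  rw [e3] at a3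
  rw [e4] at a4
  rw [norm_smul, mul_pow, norm_sub_sq_real, inner_smul_right, inner_sub_right] at a1 a3
  rw [norm_smul, mul_pow, inner_smul_right] at a2
  rw [norm_neg, norm_smul, mul_pow, inner_neg_right, inner_smul_right] at a4
  simp only [real_inner_self_eq_norm_sq, real_inner_comm p q, norm_div, norm_one,
    Real.norm_of_nonneg hL.le] at a1 a2 a3 a4
  have key : (L + μ) * ‖q‖ ^ 2 ≤ L * ⟪p, q⟫ := by
    have h : 0 ≤ L ^ 2 * (1 / L * (⟪p, q⟫ - ‖p‖ ^ 2) - 1 / L * ‖q‖ ^ 2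
        + L / 2 * ((1 / L) ^ 2 * (‖q‖ ^ 2 - 2 * ⟪p, q⟫ + ‖p‖ ^ 2)) * 2
        - μ / 2 * ((1 / L) ^ 2 * ‖q‖ ^ 2) * 2
        + 1 / L * (⟪p, q⟫ - ‖q‖ ^ 2) + 1 / L * ⟪p, q⟫) := by
      apply mul_nonneg (sq_nonneg L)
      linarith
    have e : L ^ 2 * (1 / L * (⟪p, q⟫ - ‖p‖ ^ 2) - 1 / L * ‖q‖ ^ 2
        + L / 2 * ((1 / L) ^ 2 * (‖q‖ ^ 2 - 2 * ⟪p, q⟫ + ‖p‖ ^ 2)) * 2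
        - μ / 2 * ((1 / L) ^ 2 * ‖q‖ ^ 2) * 2
        + 1 / L * (⟪p, q⟫ - ‖q‖ ^ 2) + 1 / L * ⟪p, q⟫) =
        L * ⟪p, q⟫ - (L + μ) * ‖q‖ ^ 2 := by
      field_simp
      ring
    linarith
  have h2 := real_inner_le_norm p q
  have h3 : (L + μ) * ‖q‖ ≤ L * ‖p‖ := by
    rcases (norm_nonneg q).eq_or_lt with h0 | h0
    · rw [← h0]; simp; positivity
    · refine le_of_mul_le_mul_right ?_ h0
      nlinarith
  have e5 : 1 - μ / (μ + L) = L / (L + μ) := by field_simp; ring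
  rw [e5, div_mul_eq_mul_div, le_div_iff₀ (by positivity)]
  linarith

set_option maxHeartbeats 1600000

theorem miso_convergence (d n k : ℕ) (hn : 0 < n) (μ L : ℝ)
    (hμ : 0 < μ) (hμL : μ ≤ L)
    (f : Fin n → EuclideanSpace ℝ (Fin d) → ℝ)
    (f' : Fin n → EuclideanSpace ℝ (Fin d) → EuclideanSpace ℝ (Fin d))
    (hgrad : ∀ i x, HasGradientAt (f i) (f' i x) x)
    (hsmooth : ∀ i x y, ‖f' i x - f' i y‖ ≤ L * ‖x - y‖)
    (hsc : ∀ i x y, f i x ≥ f i y + ⟪f' i y, x - y⟫ + μ / 2 * ‖x - y‖ ^ 2)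
    (φ0 wstar : EuclideanSpace ℝ (Fin d))
    (hstar : ∀ x, (1 / (n : ℝ)) * ∑ i, f i wstar ≤ (1 / (n : ℝ)) * ∑ i, f i x) :
    (1 / (n : ℝ) ^ k) * (∑ js : Fin k → Fin n,
        (1 / (n : ℝ)) * ∑ i, f i
          (misoW d n L f' (misoIter d n L f' (fun _ => φ0) (extSeq hn js) k)))
      - (1 / (n : ℝ)) * ∑ i, f i wstar
      ≤ (1 - μ / ((μ + L) * n)) ^ (2 * k) * (2 * (n : ℝ) / μ) *
          ‖(1 / (n : ℝ)) • ∑ i, f' i φ0‖ ^ 2 := by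
  have hL : 0 < L := by linarith
  have hn0 : (0 : ℝ) < n := by exact_mod_cast hn
  have hn1 : (1 : ℝ) ≤ n := by exact_mod_cast hn
  have hup : ∀ i x z, f i z ≤ f i x + ⟪f' i x, z - x⟫ + L / 2 * ‖z - x‖ ^ 2 := fun i =>
    descent L (f i) (f' i) (hgrad i) (hsmooth i)
  -- the averaged function
  set F : EuclideanSpace ℝ (Fin d) → ℝ := fun x => (1 / (n : ℝ)) * ∑ i, f i x with hF
  set G : EuclideanSpace ℝ (Fin d) → EuclideanSpace ℝ (Fin d) :=
    fun x => (1 / (n : ℝ)) • ∑ i, f' i x with hG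
  have hFsc : ∀ x y, F y + ⟪G y, x - y⟫ + μ / 2 * ‖x - y‖ ^ 2 ≤ F x := by
    intro x y
    have h1 : ∑ i, (f i y + ⟪f' i y, x - y⟫ + μ / 2 * ‖x - y‖ ^ 2) ≤ ∑ i, f i x :=
      Finset.sum_le_sum fun i _ => hsc i x y
    rw [Finset.sum_add_distrib, Finset.sum_add_distrib, ← sum_inner] at h1
    simp only [Finset.sum_const, Finset.card_univ, Fintype.card_fin, nsmul_eq_mul] at h1
    have h2 := mul_le_mul_of_nonneg_left h1 (show 0 ≤ 1 / (n : ℝ) by positivity)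
    simp only [hF, hG, real_inner_smul_left]
    refine le_trans (le_of_eq ?_) h2
    field_simp
  have hGstar : G wstar = 0 := by
    have hg : HasGradientAt F (G wstar) wstar := by
      rw [hasGradientAt_iff_hasFDerivAt]
      have h1 : HasFDerivAt (fun x => ∑ i, f i x)
          (∑ i, (InnerProductSpace.toDual ℝ _ (f' i wstar))) wstar :=
        HasFDerivAt.fun_sum fun i _ => (hgrad i wstar).hasFDerivAt
      have h2 := h1.const_mul (1 / (n : ℝ))
      refine h2.congr_fderiv ?_
      simp [hG, map_sum]
    have hmin : IsLocalMin F wstar := Filter.Eventually.of_forall hstar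
    have := hmin.hasFDerivAt_eq_zero hg.hasFDerivAt
    simpa using this
  have hFlow : ∀ x, μ / 2 * ‖x - wstar‖ ^ 2 ≤ F x - F wstar := by
    intro x
    have := hFsc x wstar
    rw [hGstar, inner_zero_left] at this
    linarith
  have hFin : ∀ x, F x - F wstar ≤ ‖G x‖ * ‖x - wstar‖ - μ / 2 * ‖x - wstar‖ ^ 2 := by
    intro x
    have h1 := hFsc wstar x
    have h2 := real_inner_le_norm (G x) (x - wstar)
    rw [← neg_sub x wstar, inner_neg_right, norm_neg] at h1
    linarith
  have hFup : ∀ x, F x - F wstar ≤ ‖G x‖ ^ 2 / μ / 2 := by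
    intro x
    have h1 := hFin x
    rw [div_div, le_div_iff₀ (by positivity)]
    nlinarith [sq_nonneg (‖G x‖ - μ * ‖x - wstar‖)]
  have hV0 : μ * ‖φ0 - wstar‖ ^ 2 ≤ ‖G φ0‖ ^ 2 / μ := by
    have h1 := hFin φ0
    have h2 := hFlow φ0
    have h3 : μ * ‖φ0 - wstar‖ ≤ ‖G φ0‖ := by
      rcases (norm_nonneg (φ0 - wstar)).eq_or_lt with h0 | h0
      · rw [← h0]; simp
      · refine le_of_mul_le_mul_right ?_ h0
        nlinarith
    rw [le_div_iff₀ hμ]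
    have := pow_le_pow_left₀ (by positivity) h3 2
    nlinarith
  set φc : Fin n → EuclideanSpace ℝ (Fin d) := fun _ => φ0 with hφc
  set W := misoW d n L f' with hW
  set A := expK d n hn L f' φc with hA
  have hgoal : (1 / (n : ℝ) ^ k) * (∑ js : Fin k → Fin n,
        F (misoW d n L f' (misoIter d n L f' φc (extSeq hn js) k))) - F wstar
      = A k (fun φ => F (W φ) - F wstar) := by
    have h := expK_lin hn L f' φc k 1 (-1) (fun φ => F (W φ)) (fun _ => F wstar)
    rw [expK_const] at h
    have e : (fun φ => F (W φ) - F wstar) = fun φ => 1 * F (W φ) + -1 * F wstar := by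
      funext φ; ring
    rw [hA, e, h]
    simp only [expK, hW]
    ring
  set s := 1 - μ / ((μ + L) * n) with hs
  change (1 / (n : ℝ) ^ k) * (∑ js : Fin k → Fin n,
        F (misoW d n L f' (misoIter d n L f' φc (extSeq hn js) k))) - F wstar
      ≤ s ^ (2 * k) * (2 * (n : ℝ) / μ) * ‖G φ0‖ ^ 2
  rw [hgoal]
  have hr0 : 0 < μ / (μ + L) := by positivity
  have hr1 : μ / (μ + L) ≤ 1 / 2 := by
    rw [div_le_div_iff₀ (by positivity) (by norm_num)]; linarith
  have hsr : s = 1 - μ / (μ + L) / n := by rw [hs, div_div]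
  rcases Nat.lt_or_ge 1 n with hn2 | hn2
  · -- the case `2 ≤ n`
    have hn2' : (2 : ℝ) ≤ n := by exact_mod_cast hn2
    set V : (Fin n → EuclideanSpace ℝ (Fin d)) → ℝ :=
      fun φ => (1 / (n : ℝ)) * ∑ i, ‖φ i - wstar‖ ^ 2 with hV
    set B : (Fin n → EuclideanSpace ℝ (Fin d)) → ℝ :=
      fun φ => surB d n L f f' φ (W φ) - F wstar with hB
    have hV_nn : ∀ φ, 0 ≤ V φ := fun φ => by simp only [hV]; positivity
    have hFB : ∀ φ x, F x ≤ surB d n L f f' φ x := by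
      intro φ x
      simp only [hF, surB]
      gcongr with i
      exact hup i (φ i) x
    have hBV : ∀ φ, 2 * B φ + L * ‖W φ - wstar‖ ^ 2 ≤ (L - μ) * V φ := by
      intro φ
      have h1 := surB_eq d n hn L hL f f' φ wstar
      have h2 : surB d n L f f' φ wstar ≤ F wstar + (L - μ) / 2 * V φ := by
        simp only [hF, hV, surB]
        have : ∑ i, (f i (φ i) + ⟪f' i (φ i), wstar - φ i⟫ + L / 2 * ‖wstar - φ i‖ ^ 2) ≤
            ∑ i, (f i wstar + (L - μ) / 2 * ‖φ i - wstar‖ ^ 2) := by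
          refine Finset.sum_le_sum fun i _ => ?_
          have := hsc i wstar (φ i)
          rw [norm_sub_rev (φ i) wstar]
          linarith
        rw [Finset.sum_add_distrib (f := fun i => f i wstar), ← Finset.mul_sum] at this
        have := mul_le_mul_of_nonneg_left this (show 0 ≤ 1 / (n : ℝ) by positivity)
        linarith
      rw [norm_sub_rev] at h1
      simp only [hB, hW]
      linarith
    have hFBφ : ∀ φ, F (W φ) - F wstar ≤ B φ := fun φ => by
      have := hFB φ (W φ)
      simp only [hB]; linarith
    have hPV : ∀ φ, (1 / (n : ℝ)) * ∑ j, V (Function.update φ j (W φ)) =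
        V φ + (‖W φ - wstar‖ ^ 2 - V φ) / n := by
      intro φ
      have h1 : ∀ j, V (Function.update φ j (W φ)) =
          V φ + (1 / n) * (‖W φ - wstar‖ ^ 2 - ‖φ j - wstar‖ ^ 2) := by
        intro j
        simp only [hV]
        rw [avg_update φ (W φ) j (fun _ y => ‖y - wstar‖ ^ 2)]
        ring
      rw [Finset.sum_congr rfl fun j _ => h1 j, Finset.sum_add_distrib,
        ← Finset.mul_sum (f := fun j => ‖W φ - wstar‖ ^ 2 - ‖φ j - wstar‖ ^ 2),
        Finset.sum_sub_distrib]
      simp only [Finset.sum_const, Finset.card_univ, Fintype.card_fin, nsmul_eq_mul]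
      have h2 : ∑ i, ‖φ i - wstar‖ ^ 2 = n * V φ := by
        simp only [hV]; field_simp
      rw [h2]
      field_simp
    have hPB : ∀ φ, (1 / (n : ℝ)) * ∑ j, B (Function.update φ j (W φ)) ≤ B φ := by
      intro φ
      have h1 : ∀ j, B (Function.update φ j (W φ)) ≤ B φ := by
        intro j
        have h2 := surB_eq d n hn L hL f f' (Function.update φ j (W φ)) (W φ)
        have h3 : surB d n L f f' (Function.update φ j (W φ)) (W φ) ≤
            surB d n L f f' φ (W φ) := by
          unfold surB
          rw [avg_update φ (W φ) j
            (fun i y => f i y + ⟪f' i y, W φ - y⟫ + L / 2 * ‖W φ - y‖ ^ 2)]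
          gcongr
          have := hup j (φ j) (W φ)
          simp only [sub_self, inner_zero_right, norm_zero]
          linarith
        have h4 : 0 ≤ L / 2 * ‖W φ - W (Function.update φ j (W φ))‖ ^ 2 := by positivity
        simp only [hB]
        linarith
      calc _ ≤ (1 / (n : ℝ)) * ∑ j : Fin n, B φ := by
            gcongr with j; exact h1 j
        _ = B φ := by simp; field_simp
    have hD : ∀ φ, (L + μ) * ‖W φ - wstar‖ ^ 2 ≤ (L - μ) * V φ := fun φ => by
      have h1 := hBV φ
      have h2 := hFBφ φ
      have h3 := hFlow (W φ)
      linarith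
    have hP1 : ∀ φ, (1 / (n : ℝ)) * ∑ j, V (Function.update φ j (W φ)) ≤ s ^ 2 * V φ := by
      intro φ
      rw [hPV, hsr]
      have h1 : ‖W φ - wstar‖ ^ 2 - V φ ≤ - (2 * (μ / (μ + L))) * V φ := by
        have := hD φ
        rw [← sub_nonneg]
        have e : -(2 * (μ / (μ + L))) * V φ - (‖W φ - wstar‖ ^ 2 - V φ) =
          ((L - μ) * V φ - (L + μ) * ‖W φ - wstar‖ ^ 2) / (μ + L) := by field_simp; ring
        rw [e]
        apply div_nonneg <;> linarith
      have h2 := div_le_div_of_nonneg_right h1 hn0.le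
      have h3 : 0 ≤ (μ / (μ + L) / n) ^ 2 * V φ := mul_nonneg (sq_nonneg _) (hV_nn φ)
      have e : (1 - μ / (μ + L) / n) ^ 2 * V φ = V φ + -(2 * (μ / (μ + L))) * V φ / n +
        (μ / (μ + L) / n) ^ 2 * V φ := by ring
      rw [e]; linarith
    have hP2 : ∀ φ, (1 / (n : ℝ)) * ∑ j, V (Function.update φ j (W φ)) ≤
        s * V φ + (-(2 * (1 - s) / μ)) * B φ := by
      intro φ
      rw [hPV, hsr]
      have h1 : ‖W φ - wstar‖ ^ 2 - V φ ≤ (-(μ * V φ) - 2 * B φ) / (μ + L) := by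
        rw [le_div_iff₀ (by positivity)]
        have h2 := hBV φ
        have h3 : ‖W φ - wstar‖ ^ 2 ≤ V φ := by
          have := hD φ
          have := hV_nn φ
          nlinarith
        nlinarith
      have h2 := div_le_div_of_nonneg_right h1 hn0.le
      refine le_trans (add_le_add_right h2 _) (le_of_eq ?_)
      field_simp
      ring
    have hb := seq_bound (fun k => μ * A k V) (fun k => A k B) s (‖G φ0‖ ^ 2 / μ)
      (by
        rw [hsr]
        have : μ / (μ + L) / n ≤ 1 / 2 / 2 := by gcongr
        linarith)
      (by
        rw [hsr]
        have : 0 < μ / (μ + L) / n := by positivity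
        linarith)
      (fun k => by
        have := expK_mono hn L f' φc k hV_nn
        rw [expK_const] at this
        exact mul_nonneg hμ.le this)
      (fun k => by
        simp only [hA]
        rw [expK_succ]
        exact expK_mono hn L f' φc k hPB)
      (fun k => by
        have h1 := expK_mono hn L f' φc k hP2
        rw [← expK_succ, expK_lin] at h1
        have h2 := mul_le_mul_of_nonneg_left h1 hμ.le
        refine le_trans h2 (le_of_eq ?_)
        simp only [hA]
        field_simp
        ring)
      (fun k => by
        have h1 := expK_mono hn L f' φc k (Φ := fun φ => s ^ 2 * V φ + 0 * V φ)
          (Ψ := fun φ => (1 / (n : ℝ)) * ∑ j, V (Function.update φ j (misoW d n L f' φ)))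
          (fun φ => by rw [zero_mul, add_zero]; exact hP1 φ)
        rw [← expK_succ, expK_lin] at h1
        have h2 := mul_le_mul_of_nonneg_left h1 hμ.le
        refine le_trans h2 (le_of_eq ?_)
        simp only [hA]
        ring)
      (by
        simp only [hA]
        rw [expK_zero]
        refine le_trans (le_of_eq ?_) hV0
        simp only [hV, hφc, Finset.sum_const, Finset.card_univ, Fintype.card_fin, nsmul_eq_mul]
        field_simp)
      (by
        simp only [hA]
        rw [expK_zero]
        refine le_trans ?_ (hFup φ0)
        have h2 := surB_eq d n hn L hL f f' φc φ0
        have h3 : surB d n L f f' φc φ0 = F φ0 := by simp [surB, hF, hφc]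
        have h4 : 0 ≤ L / 2 * ‖φ0 - W φc‖ ^ 2 := by positivity
        simp only [hB]
        linarith) k
    have hfin := (expK_mono hn L f' φc k hFBφ).trans hb
    refine hfin.trans ?_
    have h0 : 0 ≤ ‖G φ0‖ ^ 2 / μ * s ^ (2 * k) := by
      have : 0 ≤ s ^ (2 * k) := by rw [pow_mul]; positivity
      positivity
    have e : s ^ (2 * k) * (2 * (n : ℝ) / μ) * ‖G φ0‖ ^ 2 =
      2 * n * (‖G φ0‖ ^ 2 / μ * s ^ (2 * k)) := by ring
    rw [e]
    nlinarith
  · -- the case `n = 1`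
    obtain rfl : n = 1 := by omega
    set Γ : (Fin 1 → EuclideanSpace ℝ (Fin d)) → ℝ := fun φ => ‖G (φ 0)‖ ^ 2 with hΓ
    have hs0 : 0 ≤ s := by rw [hsr]; simp; linarith
    have hs1 : s ≤ 1 := by rw [hsr]; simp; linarith
    have hGf : ∀ x, G x = f' 0 x := fun x => by simp [hG]
    have hWφ : ∀ φ, W φ = φ 0 - (1 / L) • f' 0 (φ 0) := fun φ => by simp [hW, misoW]
    have hc : ∀ φ, ‖G (W φ)‖ ^ 2 ≤ s ^ 2 * Γ φ := by
      intro φ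
      have := gd_contract μ L hμ hμL (f 0) (f' 0) (hup 0) (hsc 0) (φ 0)
      rw [← hWφ, ← hGf, ← hGf] at this
      have h1 : s = 1 - μ / (μ + L) := by rw [hsr]; simp
      rw [← h1] at this
      have := pow_le_pow_left₀ (norm_nonneg _) this 2
      rwa [mul_pow] at this
    have hk : ∀ k, A k Γ ≤ s ^ (2 * k) * ‖G φ0‖ ^ 2 := by
      intro k
      induction k with
      | zero => simp only [hA]; rw [expK_zero]; simp [hΓ, hφc]
      | succ k ih =>
        have h1 := expK_mono hn L f' φc k (Φ := fun φ => s ^ 2 * Γ φ + 0 * Γ φ)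
          (Ψ := fun φ => (1 / ((1 : ℕ) : ℝ)) * ∑ j, Γ (Function.update φ j (misoW d 1 L f' φ)))
          (fun φ => by
            have := hc φ
            simpa [hΓ] using this)
        rw [← expK_succ, expK_lin] at h1
        have h2 := mul_le_mul_of_nonneg_left ih (sq_nonneg s)
        calc A (k + 1) Γ ≤ s ^ 2 * A k Γ + 0 * A k Γ := h1
          _ ≤ s ^ 2 * (s ^ (2 * k) * ‖G φ0‖ ^ 2) := by linarith
          _ = _ := by ring
    have hlast : ∀ φ, F (W φ) - F wstar ≤ (1 / (2 * μ)) * Γ φ + 0 * Γ φ := by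
      intro φ
      have h1 := hFup (W φ)
      have h2 := hc φ
      have h3 : s ^ 2 * Γ φ ≤ 1 * Γ φ := by
        apply mul_le_mul_of_nonneg_right _ (by positivity)
        nlinarith
      have h4 : ‖G (W φ)‖ ^ 2 / μ / 2 ≤ Γ φ / μ / 2 := by
        gcongr; linarith
      refine (h1.trans h4).trans (le_of_eq ?_)
      field_simp
      ring
    have h1 := expK_mono hn L f' φc k hlast
    rw [expK_lin] at h1
    refine h1.trans ?_
    have h2 := mul_le_mul_of_nonneg_left (hk k) (show 0 ≤ 1 / (2 * μ) by positivity)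
    have h0 : 0 ≤ s ^ (2 * k) * ‖G φ0‖ ^ 2 / μ := by positivity
    have e : s ^ (2 * k) * (2 * ((1 : ℕ) : ℝ) / μ) * ‖G φ0‖ ^ 2 =
      2 * (s ^ (2 * k) * ‖G φ0‖ ^ 2 / μ) := by push_cast; ring
    have e2 : 1 / (2 * μ) * (s ^ (2 * k) * ‖G φ0‖ ^ 2) =
      (1 / 2) * (s ^ (2 * k) * ‖G φ0‖ ^ 2 / μ) := by field_simp
    rw [e]
    rw [e2] at h2
    simp only [hA] at h2
    linarith
end
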